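/- arXiv:1810.13255 — 2 statements merged into one kernel-verified Lean document; each statement's English description precedes it below -/
import Mathlib

section
/- Let φ: Λ → Λ be the algebra homomorphism on the ring of symmetric functions (over ℚ) determined by φ(p_r) = 2p_r for odd r and φ(p_r) = 0 for even r, where p_r are the power sums. Then for every strict partition λ, φ(s_{D(λ)}) = 2^{-ℓ(λ)} (Q_λ)², where s_μ is the Schur function, Q_λ is the Schur Q-function, D(λ) is the double of λ, and ℓ(λ) the number of parts. -/
/-- The ring of symmetric functions over ℚ, presented as the polynomial algebra
`Λ = ℚ[p₁, p₂, p₃, …]` in the power sums: the variable `X r` represents the power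
sum `p_r` (for `r ≥ 1`; the variable `X 0` is unused). -/
abbrev SymFn : Type := MvPolynomial ℕ ℚ

/-- The power sum `p_r` as an element of `Λ`. -/
noncomputable def pvar (r : ℕ) : SymFn := MvPolynomial.X r

/-- The algebra homomorphism `φ : Λ → Λ` determined by `φ(p_r) = 2 p_r` for odd `r`
and `φ(p_r) = 0` for even `r`. -/
noncomputable def phi : SymFn →ₐ[ℚ] SymFn :=
  MvPolynomial.aeval fun r => if Odd r then 2 * pvar r else 0

/-- The complete homogeneous symmetric functions `h_n`, via Newton's identity
`n h_n = ∑_{r=1}^{n} p_r h_{n-r}`. -/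
noncomputable def hfun : ℕ → SymFn
  | 0 => 1
  | n + 1 => (((n : ℚ) + 1)⁻¹) •
      ∑ r ∈ Finset.range (n + 1), pvar (r + 1) * hfun (n - r)
  termination_by n => n
  decreasing_by omega

/-- `h_m` for `m ∈ ℤ`, with `h_m = 0` for `m < 0`. -/
noncomputable def hz (z : ℤ) : SymFn := if 0 ≤ z then hfun z.toNat else 0

/-- Schur's functions `q_n`, determined by the generating series
`∑ q_n t^n = exp(∑_{r odd} 2 p_r t^r / r)`, i.e. `q_0 = 1` and
`n q_n = ∑_{r odd, r ≤ n} 2 p_r q_{n-r}`. -/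
noncomputable def qfun : ℕ → SymFn
  | 0 => 1
  | n + 1 => (((n : ℚ) + 1)⁻¹) •
      ∑ r ∈ Finset.range (n + 1),
        if Odd (r + 1) then 2 * pvar (r + 1) * qfun (n - r) else 0
  termination_by n => n
  decreasing_by omega

/-- The parts of the double `D(λ)` of a strict partition `λ` (with `ℓ` parts
`lam 1 > ⋯ > lam ℓ`): `D(λ)_k = λ_k + k` for `1 ≤ k ≤ ℓ`, and for `k > ℓ` the
`k`-th part is the number of indices `j` with `λ_j + j - 1 ≥ k`. -/
def Dpart (ℓ : ℕ) (lam : ℕ → ℕ) (k : ℕ) : ℕ :=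
  if k = 0 then 0
  else if k ≤ ℓ then lam k + k
  else ((Finset.Icc 1 ℓ).filter fun j => k + 1 ≤ lam j + j).card

/-- The Schur function `s_{D(λ)}`, via the Jacobi–Trudi determinant
`s_μ = det(h_{μ_i - i + j})`. -/
noncomputable def schurD (ℓ : ℕ) (lam : ℕ → ℕ) : SymFn :=
  Matrix.det (Matrix.of fun i j : Fin (lam 1 + ℓ + 1) =>
    hz ((Dpart ℓ lam (i + 1) : ℤ) + (j : ℤ) - (i : ℤ)))

/-- The two-row Schur Q-function
`Q_{(r,s)} = q_r q_s + 2 ∑_{i=1}^{s} (-1)^i q_{r+i} q_{s-i}` (so `Q_{(r,0)} = q_r`). -/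
noncomputable def Qpair (r s : ℕ) : SymFn :=
  qfun r * qfun s + 2 * ∑ i ∈ Finset.Icc 1 s, (-1 : SymFn) ^ i * qfun (r + i) * qfun (s - i)

/-- The Schur Q-function `Q_λ` of a strict partition `λ` with `ℓ` parts, via the
Pfaffian `Q_λ = Pf(Q_{(λ_i, λ_j)})_{1 ≤ i,j ≤ m}` (with `m = ℓ` or `ℓ + 1` made
even by appending a zero part), where the Pfaffian of an antisymmetric `2h × 2h`
matrix `A` is `(2^h h!)⁻¹ ∑_{σ ∈ S_{2h}} sgn(σ) ∏_{i=1}^{h} A_{σ(2i-1) σ(2i)}`. -/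
noncomputable def schurQ (ℓ : ℕ) (lam : ℕ → ℕ) : SymFn :=
  if ℓ = 0 then 1 else
  let h : ℕ := (ℓ + 1) / 2
  let A : Fin (2 * h) → Fin (2 * h) → SymFn := fun i j =>
    if (i : ℕ) < (j : ℕ) then Qpair (lam ((i : ℕ) + 1)) (lam ((j : ℕ) + 1))
    else if (j : ℕ) < (i : ℕ) then -Qpair (lam ((j : ℕ) + 1)) (lam ((i : ℕ) + 1))
    else 0
  ((2 ^ h * Nat.factorial h : ℚ))⁻¹ •
    ∑ σ : Equiv.Perm (Fin (2 * h)), (Equiv.Perm.sign σ : ℤ) •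
      ∏ i : Fin h,
        A (σ ⟨2 * (i : ℕ), by have := i.isLt; omega⟩)
          (σ ⟨2 * (i : ℕ) + 1, by have := i.isLt; omega⟩)

open Equiv Equiv.Perm Finset in
theorem sum_sign_mul_prod_sum_det {R : Type*} [CommRing R] {h : ℕ}
    (P : Matrix (Fin h × Fin 2) (Fin h × Fin 2) R) :
    ∑ σ : Perm (Fin h × Fin 2), ((sign σ : ℤ) : R) *
      ∏ i, ∑ k, (Matrix.of fun w z => P (σ (i, z)) (k, w)).det =
    (2 ^ h * h.factorial : ℕ) * P.det := by
  have key : ∀ (ρ : Fin h → Fin h) (ε : Fin h → Perm (Fin 2)),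
      ∑ σ : Perm (Fin h × Fin 2), ((sign σ : ℤ) : R) *
        ∏ i, (((sign (ε i) : ℤ) : R) * ∏ z, P (σ (i, z)) (ρ i, ε i z)) =
      if Function.Injective ρ then P.det else 0 := by
    intro ρ ε
    have h1 : ∑ σ : Perm (Fin h × Fin 2), ((sign σ : ℤ) : R) *
        ∏ i, (((sign (ε i) : ℤ) : R) * ∏ z, P (σ (i, z)) (ρ i, ε i z)) =
        (∏ i, ((sign (ε i) : ℤ) : R)) *
          (P.submatrix id fun y : Fin h × Fin 2 => (ρ y.1, ε y.1 y.2)).det := by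
      rw [Matrix.det_apply', mul_sum]
      refine sum_congr rfl fun σ _ => ?_
      rw [prod_mul_distrib, Fintype.prod_prod_type]
      simp only [Matrix.submatrix_apply, id]
      ring
    rw [h1]
    split_ifs with hρ
    · let r : Perm (Fin h) := Equiv.ofBijective ρ (Finite.injective_iff_bijective.1 hρ)
      have h2 : (fun y : Fin h × Fin 2 => (ρ y.1, ε y.1 y.2)) =
          ⇑((prodCongrLeft fun _ : Fin 2 => r) * prodCongrRight ε) := by
        ext y <;> simp [r, prodCongrLeft, prodCongrRight]
      rw [h2, Matrix.det_permute', Equiv.Perm.sign_mul, sign_prodCongrLeft, sign_prodCongrRight]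
      have h3 : (∏ i, ((sign (ε i) : ℤ) : R)) * ∏ i, ((sign (ε i) : ℤ) : R) = 1 := by
        rw [← prod_mul_distrib]
        refine prod_eq_one fun i _ => ?_
        rw [← Int.cast_mul, ← Units.val_mul, Int.units_mul_self]; simp
      have h4 : ((sign r : ℤ) : R) * ((sign r : ℤ) : R) = 1 := by
        rw [← Int.cast_mul, ← Units.val_mul, Int.units_mul_self]; simp
      simp only [Fin.prod_univ_two, Units.val_mul, Units.coe_prod, Int.cast_mul, Int.cast_prod]
      rw [h4, one_mul, ← mul_assoc, h3, one_mul]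
    · simp only [Function.Injective, not_forall] at hρ
      obtain ⟨a, b, hab, hne⟩ := hρ
      rw [Matrix.det_zero_of_column_eq (i := (a, (ε a)⁻¹ 0)) (j := (b, (ε b)⁻¹ 0)), mul_zero]
      · simp [hne]
      · intro k; simp [hab]
  calc _ = ∑ c : (Fin h → Fin h) × (Fin h → Perm (Fin 2)),
        if Function.Injective c.1 then P.det else 0 := by
        refine Eq.trans ?_ (sum_congr rfl fun c _ => key c.1 c.2)
        rw [sum_comm]
        refine sum_congr rfl fun σ _ => ?_
        rw [← mul_sum]
        congr 1
        have h1 : ∀ i, ∑ k, (Matrix.of fun w z => P (σ (i, z)) (k, w)).det =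
            ∑ c : Fin h × Perm (Fin 2),
              ((sign c.2 : ℤ) : R) * ∏ z, P (σ (i, z)) (c.1, c.2 z) := fun i => by
          rw [Fintype.sum_prod_type]
          exact sum_congr rfl fun k _ => Matrix.det_apply' _
        rw [prod_congr rfl fun i _ => h1 i, prod_univ_sum, Fintype.piFinset_univ]
        exact Fintype.sum_equiv (Equiv.arrowProdEquivProdArrow _ _ _) _ _ fun c => rfl
    _ = _ := by
        rw [Fintype.sum_prod_type]
        refine (sum_congr rfl (g := fun ρ => (2 ^ h) • (if Function.Injective ρ then P.det else 0))
          fun ρ _ => by by_cases hρ : Function.Injective ρ <;> simp [hρ, Fintype.card_perm]).trans ?_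
        rw [← smul_sum, ← sum_filter, sum_const, ← Fintype.card_subtype,
          Fintype.card_congr (Equiv.subtypeInjectiveEquivEmbedding (Fin h) (Fin h)),
          Fintype.card_embedding_eq]
        simp [Nat.descFactorial_self, mul_assoc]

theorem exists_sum_wedge_of_alternating {K ι : Type*} [Field K] [DecidableEq ι] (h : ℕ) :
    ∀ (s : Finset ι) (A : ι → ι → K), s.card ≤ 2 * h + 1 → (∀ a, A a a = 0) →
      (∀ a b, A a b = -A b a) → (∀ a b, A a b ≠ 0 → a ∈ s) →
      ∃ x y : Fin h → ι → K, ∀ a b, A a b = ∑ k, (x k a * y k b - y k a * x k b) := by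
  induction h with
  | zero =>
    intro s A hs hd ha hsupp
    refine ⟨Fin.elim0, Fin.elim0, fun a b => ?_⟩
    by_contra hne
    simp only [Finset.univ_eq_empty, Finset.sum_empty] at hne
    have h1 := hsupp a b hne
    have h2 := hsupp b a (by rw [ha]; simpa using hne)
    have := Finset.card_le_one.1 (by simpa using hs) a h1 b h2
    exact hne (this ▸ hd a)
  | succ h ih =>
    intro s A hs hd ha hsupp
    by_cases h0 : ∀ a b, A a b = 0
    · exact ⟨0, 0, fun a b => by simp [h0]⟩
    push Not at h0
    obtain ⟨u, v, huv⟩ := h0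
    have hne : u ≠ v := by rintro rfl; exact huv (hd u)
    have hu := hsupp u v huv
    have hv := hsupp v u (by rw [ha]; simpa using huv)
    let x : ι → K := fun a => A a u / A u v
    let y : ι → K := fun a => A a v
    let A' : ι → ι → K := fun a b => A a b - (x a * y b - y a * x b)
    have hA' : ∀ a b, A' a b = -A' b a := fun a b => by
      simp only [A']; rw [ha a b]; ring
    have hA'u : ∀ b, A' u b = 0 := fun b => by
      simp only [A', x, y, hd]; rw [ha u b]; field_simp; ring
    have hA'v : ∀ b, A' v b = 0 := fun b => by
      simp only [A', x, y, hd]; rw [ha v b, ha v u]; field_simp; ring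
    obtain ⟨x', y', hxy⟩ := ih ((s.erase u).erase v) A' (by
        rw [Finset.card_erase_of_mem (by simp [hne.symm, hv]), Finset.card_erase_of_mem hu]; omega)
      (fun a => by simp only [A', hd]; ring) hA' (fun a b hab => by
        rw [Finset.mem_erase, Finset.mem_erase]
        refine ⟨?_, ?_, ?_⟩
        · rintro rfl; exact hab (hA'v b)
        · rintro rfl; exact hab (hA'u b)
        · by_contra has
          have hz : ∀ c, A a c = 0 := fun c => by_contra fun hc => has (hsupp a c hc)
          exact hab (by simp [A', x, y, hz]))
    refine ⟨Fin.cons x x', Fin.cons y y', fun a b => ?_⟩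
    rw [Fin.sum_univ_succ]
    simp only [Fin.cons_zero, Fin.cons_succ, ← hxy]
    simp [A']

open Equiv Equiv.Perm Finset Kronecker in
theorem pfaffianSum_sq_of_field {K : Type*} [Field K] {h : ℕ}
    (A : Matrix (Fin h × Fin 2) (Fin h × Fin 2) K)
    (hd : ∀ a, A a a = 0) (ha : ∀ a b, A a b = -A b a) :
    (∑ σ : Perm (Fin h × Fin 2), ((sign σ : ℤ) : K) * ∏ i, A (σ (i, 0)) (σ (i, 1))) ^ 2 =
      ((2 ^ h * h.factorial : ℕ) : K) ^ 2 * A.det := by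
  obtain ⟨x, y, hxy⟩ := exists_sum_wedge_of_alternating h univ A
    (by simp [mul_comm]) hd ha (fun _ _ _ => mem_univ _)
  let P : Matrix (Fin h × Fin 2) (Fin h × Fin 2) K :=
    Matrix.of fun a k => if k.2 = 0 then x k.1 a else y k.1 a
  have h1 := sum_sign_mul_prod_sum_det P
  have h2 : A = P * ((1 : Matrix (Fin h) (Fin h) K) ⊗ₖ !![0, 1; -1, 0]) * P.transpose := by
    ext a b
    rw [hxy, Matrix.mul_apply, Fintype.sum_prod_type]
    refine sum_congr rfl fun k _ => ?_
    simp [Matrix.mul_apply, Fintype.sum_prod_type, P, Matrix.one_apply]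
    ring
  have h3 : A.det = P.det ^ 2 := by
    rw [h2, Matrix.det_mul, Matrix.det_mul, Matrix.det_kronecker, Matrix.det_transpose]
    simp; ring
  have h4 : ∀ a b, A a b = ∑ k, (Matrix.of fun (w z : Fin 2) => P (![a, b] z) (k, w)).det := by
    intro a b
    rw [hxy]
    refine sum_congr rfl fun k _ => ?_
    simp [Matrix.det_fin_two, P]
    ring
  rw [h3, ← mul_pow, ← h1]
  congr 1
  refine sum_congr rfl fun σ _ => ?_
  congr 1
  refine prod_congr rfl fun i _ => ?_
  rw [h4]
  refine sum_congr rfl fun k _ => ?_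
  simp [Matrix.det_fin_two]

open Equiv Equiv.Perm Finset in
theorem pfaffianSum_sq {R : Type*} [CommRing R] [IsDomain R] {h : ℕ}
    (A : Matrix (Fin (2 * h)) (Fin (2 * h)) R)
    (hd : ∀ a, A a a = 0) (ha : ∀ a b, A a b = -A b a) :
    (∑ σ : Perm (Fin (2 * h)), (sign σ : ℤ) •
      ∏ i : Fin h, A (σ ⟨2 * (i : ℕ), by have := i.isLt; omega⟩)
        (σ ⟨2 * (i : ℕ) + 1, by have := i.isLt; omega⟩)) ^ 2 =
      ((2 ^ h * h.factorial : ℕ) : R) ^ 2 * A.det := by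
  let e : Fin h × Fin 2 ≃ Fin (2 * h) := finProdFinEquiv.trans (finCongr (mul_comm _ _))
  have he0 : ∀ i : Fin h, e (i, 0) = ⟨2 * (i : ℕ), by have := i.isLt; omega⟩ := fun i => by
    ext; simp [e]
  have he1 : ∀ i : Fin h, e (i, 1) = ⟨2 * (i : ℕ) + 1, by have := i.isLt; omega⟩ := fun i => by
    ext; simp [e]; ring
  apply IsFractionRing.injective R (FractionRing R)
  have := pfaffianSum_sq_of_field ((A.submatrix e e).map (algebraMap R (FractionRing R)))
    (by simp [hd]) (fun a b => by simp [ha (e a) (e b)])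
  rw [← RingHom.mapMatrix_apply, ← RingHom.map_det, Matrix.det_submatrix_equiv_self] at this
  rw [map_mul, map_pow, map_pow, map_natCast, ← this, map_sum]
  congr 1
  refine Fintype.sum_equiv e.symm.permCongr _ _ fun σ => ?_
  rw [Equiv.Perm.sign_permCongr]
  simp [he0, he1]

theorem det_eq_zero_of_antisymm_of_odd {R : Type*} [CommRing R] [IsDomain R] [CharZero R] {n : ℕ}
    (hn : Odd n) (A : Matrix (Fin n) (Fin n) R) (ha : ∀ a b, A a b = -A b a) : A.det = 0 := by
  have h1 : A.transpose = -A := by ext a b; simp [ha b a]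
  have h2 := A.det_transpose
  rw [h1, Matrix.det_neg, Fintype.card_fin, hn.neg_one_pow] at h2
  have h3 : 2 * A.det = 0 := by linear_combination -h2
  simpa using h3

theorem sum_Icc_one_eq_sum_range {M : Type*} [AddCommMonoid M] (f : ℕ → M) (n : ℕ) :
    ∑ i ∈ Finset.Icc 1 n, f i = ∑ i ∈ Finset.range n, f (i + 1) := by
  rw [Finset.range_eq_Ico, Finset.sum_Ico_add' f 0 n 1]
  rfl

theorem phi_hfun (n : ℕ) : phi (hfun n) = qfun n := by
  induction n using Nat.strong_induction_on with
  | _ n ih =>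
    cases n with
    | zero => rw [hfun, qfun, map_one]
    | succ n =>
      rw [hfun, qfun, map_smul, map_sum]
      congr 1
      refine Finset.sum_congr rfl fun r _ => ?_
      rw [map_mul, ih (n - r) (by omega)]
      have : phi (pvar (r + 1)) = if Odd (r + 1) then 2 * pvar (r + 1) else 0 := by
        simp only [phi, pvar, MvPolynomial.aeval_X]
      rw [this, ite_mul, zero_mul]

/-- `q_m` for `m ∈ ℤ`, with `q_m = 0` for `m < 0`. -/
noncomputable def qz (z : ℤ) : SymFn := if 0 ≤ z then qfun z.toNat else 0

theorem phi_hz (z : ℤ) : phi (hz z) = qz z := by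
  unfold hz qz
  split_ifs
  · exact phi_hfun _
  · exact map_zero _

theorem qz_natCast (n : ℕ) : qz n = qfun n := by simp [qz]

/-- The generating series `∑ q_n t^n`. -/
noncomputable def qSeries : PowerSeries SymFn := PowerSeries.mk qfun

theorem derivative_qSeries : PowerSeries.derivative SymFn qSeries =
    (PowerSeries.mk fun r => if Odd (r + 1) then 2 * pvar (r + 1) else 0) * qSeries := by
  ext1 n
  rw [PowerSeries.coeff_derivative, PowerSeries.coeff_mul,
    Finset.Nat.sum_antidiagonal_eq_sum_range_succ_mk]
  simp only [qSeries, PowerSeries.coeff_mk]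
  rw [qfun, mul_comm, Algebra.smul_def, ← mul_assoc]
  have : ((n : SymFn) + 1) * algebraMap ℚ SymFn ((n : ℚ) + 1)⁻¹ = 1 := by
    have h : ((n : SymFn) + 1) = algebraMap ℚ SymFn ((n : ℚ) + 1) := by simp
    rw [h, ← map_mul, mul_inv_cancel₀ (by positivity), map_one]
  rw [this, one_mul]
  refine Finset.sum_congr rfl fun r _ => ?_
  rw [ite_mul, zero_mul]

theorem qSeries_mul_rescale_neg_one :
    qSeries * PowerSeries.rescale (-1 : SymFn) qSeries = 1 := by
  have h : PowerSeries.derivative SymFn (PowerSeries.rescale (-1 : SymFn) qSeries) =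
      -(PowerSeries.mk fun r => if Odd (r + 1) then 2 * pvar (r + 1) else 0) *
        PowerSeries.rescale (-1 : SymFn) qSeries := by
    have h1 : PowerSeries.derivative SymFn (PowerSeries.rescale (-1 : SymFn) qSeries) =
        -PowerSeries.rescale (-1 : SymFn) (PowerSeries.derivative SymFn qSeries) := by
      ext1 n
      rw [map_neg]
      simp only [PowerSeries.coeff_derivative, PowerSeries.coeff_rescale]
      ring
    rw [h1, derivative_qSeries, map_mul, neg_mul]
    congr 2
    ext1 n
    rw [PowerSeries.coeff_rescale, PowerSeries.coeff_mk]
    split_ifs with ho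
    · rw [Even.neg_one_pow (by grind), one_mul]
    · rw [mul_zero]
  apply PowerSeries.derivative.ext
  · rw [Derivation.leibniz, h, derivative_qSeries, PowerSeries.derivative_one]
    simp only [smul_eq_mul]
    ring
  · have h0 : PowerSeries.constantCoeff qSeries = 1 := by
      rw [← PowerSeries.coeff_zero_eq_constantCoeff_apply, qSeries, PowerSeries.coeff_mk, qfun]
    have h1 : PowerSeries.constantCoeff (PowerSeries.rescale (-1 : SymFn) qSeries) = 1 := by
      rw [← PowerSeries.coeff_zero_eq_constantCoeff_apply, PowerSeries.coeff_rescale,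
        PowerSeries.coeff_zero_eq_constantCoeff_apply, h0]
      simp
    rw [map_mul, h0, h1, map_one, mul_one]

theorem sum_qfun_mul_neg_one_pow_qfun (n : ℕ) :
    ∑ k ∈ Finset.range (n + 1), (-1) ^ (n - k) * qfun k * qfun (n - k) = if n = 0 then 1 else 0 := by
  have h := congrArg (PowerSeries.coeff n) qSeries_mul_rescale_neg_one
  rw [PowerSeries.coeff_mul, PowerSeries.coeff_one,
    Finset.Nat.sum_antidiagonal_eq_sum_range_succ_mk] at h
  rw [← h]
  refine Finset.sum_congr rfl fun k _ => ?_
  simp only [PowerSeries.coeff_rescale, qSeries, PowerSeries.coeff_mk]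
  ring

theorem sum_neg_one_pow_qfun_mul_qfun {n : ℕ} (hn : n ≠ 0) :
    ∑ k ∈ Finset.range (n + 1), (-1) ^ k * qfun k * qfun (n - k) = 0 := by
  have h := sum_qfun_mul_neg_one_pow_qfun n
  rw [if_neg hn, ← Finset.sum_range_reflect] at h
  rw [← h]
  refine Finset.sum_congr rfl fun k hk => ?_
  have hk' : k ≤ n := by simpa [Nat.lt_succ_iff] using hk
  rw [show n + 1 - 1 - k = n - k by omega, show n - (n - k) = k by omega]
  ring

theorem Qpair_eq (a b : ℕ) : Qpair a b = (-1) ^ b * ((-1) ^ b * qfun b * qfun (a + b - b) +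
    2 * ∑ k ∈ Finset.range b, (-1) ^ k * qfun k * qfun (a + b - k)) := by
  have hb : ((-1 : SymFn) ^ b) * (-1) ^ b = 1 := by rw [← mul_pow]; simp
  have h : ∑ i ∈ Finset.Icc 1 b, (-1 : SymFn) ^ i * qfun (a + i) * qfun (b - i) =
      (-1) ^ b * ∑ k ∈ Finset.range b, (-1) ^ k * qfun k * qfun (a + b - k) := by
    rw [← Finset.sum_range_reflect, Finset.mul_sum, sum_Icc_one_eq_sum_range]
    refine Finset.sum_congr rfl fun k hk => ?_
    have hk' : k < b := by simpa using hk
    rw [show b - 1 - k = b - (k + 1) by omega, show a + b - (b - (k + 1)) = a + (k + 1) by omega]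
    have hs : (-1 : SymFn) ^ b * (-1) ^ (b - (k + 1)) = (-1) ^ (k + 1) := by
      rw [← pow_add, show b + (b - (k + 1)) = 2 * (b - (k + 1)) + (k + 1) by omega, pow_add, pow_mul]
      simp
    rw [← hs]; ring
  rw [Qpair, h, Nat.add_sub_cancel]
  linear_combination -(qfun a * qfun b) * hb

theorem Qpair_antisymm {a b : ℕ} (h : a + b ≠ 0) : Qpair a b = -Qpair b a := by
  have hs := sum_neg_one_pow_qfun_mul_qfun h
  have hab : ∀ k ≤ a + b, (-1 : SymFn) ^ a * ((-1) ^ k * qfun k * qfun (a + b - k)) =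
      (-1) ^ b * ((-1) ^ (a + b - k) * qfun (a + b - k) * qfun (a + b - (a + b - k))) := by
    intro k hk
    have hp : (-1 : SymFn) ^ a * (-1) ^ k = (-1) ^ b * (-1) ^ (a + b - k) := by
      rw [← pow_add, ← pow_add]
      rcases Nat.even_or_odd (a + k) with he | he
      · rw [he.neg_one_pow, Even.neg_one_pow (by grind)]
      · rw [he.neg_one_pow, Odd.neg_one_pow (by grind)]
    rw [show a + b - (a + b - k) = k by omega]
    linear_combination (qfun k * qfun (a + b - k)) * hp
  have h1 : (-1 : SymFn) ^ a * ∑ k ∈ Finset.range a, (-1) ^ k * qfun k * qfun (a + b - k) =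
      (-1) ^ b * ∑ k ∈ Finset.range a,
        (-1) ^ (b + 1 + k) * qfun (b + 1 + k) * qfun (a + b - (b + 1 + k)) := by
    rw [← Finset.sum_range_reflect, Finset.mul_sum, Finset.mul_sum]
    refine Finset.sum_congr rfl fun k hk => ?_
    have hk' : k < a := by simpa using hk
    rw [hab _ (by omega), show a + b - (a - 1 - k) = b + 1 + k by omega]
  have h2 := hab a (by omega)
  rw [Qpair_eq a b, Qpair_eq b a, add_comm b a]
  rw [show a + b + 1 = b + 1 + a by omega, Finset.sum_range_add, Finset.sum_range_succ] at hs
  rw [show a + b - a = b by omega, show a + b - b = a by omega] at *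
  linear_combination h2 + 2 * h1 + 2 * (-1) ^ b * hs

theorem Qpair_zero_right (a : ℕ) : Qpair a 0 = qfun a := by
  simp [Qpair, qfun]

theorem Qpair_self {a : ℕ} (h : a ≠ 0) : Qpair a a = 0 := by
  have := Qpair_antisymm (a := a) (b := a) (by omega)
  exact self_eq_neg.1 this

theorem two_mul_sum_hook {a b : ℕ} (hb : 0 < b) :
    2 * ∑ j ∈ Finset.range b, qfun (a + 1 + j) * ((-1) ^ (b - 1 - j) * qfun (b - 1 - j)) =
      (-1) ^ (b - 1) * (qfun a * qfun b - Qpair a b) := by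
  have h : ∑ i ∈ Finset.Icc 1 b, (-1 : SymFn) ^ i * qfun (a + i) * qfun (b - i) =
      -(-1) ^ (b - 1) *
        ∑ j ∈ Finset.range b, qfun (a + 1 + j) * ((-1) ^ (b - 1 - j) * qfun (b - 1 - j)) := by
    rw [Finset.mul_sum, sum_Icc_one_eq_sum_range]
    refine Finset.sum_congr rfl fun j hj => ?_
    have hj' : j < b := by simpa using hj
    have hs : (-1 : SymFn) ^ (b - 1) * (-1) ^ (b - 1 - j) = (-1) ^ j := by
      rw [← pow_add, show b - 1 + (b - 1 - j) = 2 * (b - 1 - j) + j by omega, pow_add, pow_mul]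
      simp
    rw [show b - (j + 1) = b - 1 - j by omega, show a + (j + 1) = a + 1 + j by omega, pow_succ, ← hs]
    ring
  have hb' : ((-1 : SymFn) ^ (b - 1)) * (-1) ^ (b - 1) = 1 := by rw [← mul_pow]; simp
  rw [Qpair, h]
  linear_combination (-2 * ∑ j ∈ Finset.range b,
    qfun (a + 1 + j) * ((-1) ^ (b - 1 - j) * qfun (b - 1 - j))) * hb'

theorem iff_le_card_filter_Icc {ℓ : ℕ} {p : ℕ → Prop} [DecidablePred p]
    (hp : ∀ i j, 1 ≤ i → i ≤ j → j ≤ ℓ → p j → p i) {j : ℕ} (h1 : 1 ≤ j) (hj : j ≤ ℓ) :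
    p j ↔ j ≤ ((Finset.Icc 1 ℓ).filter p).card := by
  constructor
  · intro h
    have hs : Finset.Icc 1 j ⊆ (Finset.Icc 1 ℓ).filter p := fun i hi => by
      rw [Finset.mem_Icc] at hi
      rw [Finset.mem_filter, Finset.mem_Icc]
      exact ⟨⟨hi.1, hi.2.trans hj⟩, hp i j hi.1 hi.2 hj h⟩
    simpa using Finset.card_le_card hs
  · intro h
    by_contra hn
    have hs : (Finset.Icc 1 ℓ).filter p ⊆ Finset.Icc 1 (j - 1) := fun i hi => by
      rw [Finset.mem_filter, Finset.mem_Icc] at hi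
      rw [Finset.mem_Icc]
      refine ⟨hi.1.1, ?_⟩
      by_contra hlt
      exact hn (hp j i h1 (by omega) hi.1.2 hi.2)
    have := Finset.card_le_card hs
    rw [Nat.card_Icc] at this
    omega

theorem strict_add_le {ℓ : ℕ} {lam : ℕ → ℕ}
    (hstrict : ∀ i, 1 ≤ i → i < ℓ → lam (i + 1) < lam i) {i j : ℕ} (hi : 1 ≤ i) (hij : i ≤ j)
    (hj : j ≤ ℓ) : lam j + j ≤ lam i + i := by
  induction j, hij using Nat.le_induction with
  | base => exact le_rfl
  | succ j hij ih =>
    have := hstrict j (by omega) (by omega)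
    have := ih (by omega)
    omega

theorem Dpart_of_le {ℓ : ℕ} {lam : ℕ → ℕ} {k : ℕ} (hk : ℓ ≤ k) :
    Dpart ℓ lam (k + 1) = ((Finset.Icc 1 ℓ).filter fun j => k + 2 ≤ lam j + j).card := by
  rw [Dpart, if_neg (by omega), if_neg (by omega)]

theorem Dpart_le {ℓ : ℕ} {lam : ℕ → ℕ} {k : ℕ} (hk : ℓ ≤ k) : Dpart ℓ lam (k + 1) ≤ ℓ := by
  rw [Dpart_of_le hk]
  exact (Finset.card_filter_le _ _).trans (by simp)

theorem Dpart_antitone {ℓ : ℕ} {lam : ℕ → ℕ} {k k' : ℕ} (hk : ℓ ≤ k) (hkk : k ≤ k') :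
    Dpart ℓ lam (k' + 1) ≤ Dpart ℓ lam (k + 1) := by
  rw [Dpart_of_le hk, Dpart_of_le (hk.trans hkk)]
  refine Finset.card_le_card fun j hj => ?_
  rw [Finset.mem_filter] at hj ⊢
  exact ⟨hj.1, by omega⟩

theorem lt_iff_le_Dpart {ℓ : ℕ} {lam : ℕ → ℕ} (hpos : ∀ i, 1 ≤ i → i ≤ ℓ → 0 < lam i)
    (hstrict : ∀ i, 1 ≤ i → i < ℓ → lam (i + 1) < lam i) {k i : ℕ} (hk : ℓ ≤ k) (hi : 1 ≤ i)
    (hiℓ : i ≤ ℓ) :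
    (i ≤ Dpart ℓ lam (k + 1) ∧ k - Dpart ℓ lam (k + 1) < lam i - 1) ∨
      (Dpart ℓ lam (k + 1) < i ∧ lam i - 1 < k - Dpart ℓ lam (k + 1)) := by
  have hD := Dpart_le (lam := lam) hk
  have key : ∀ j, 1 ≤ j → j ≤ ℓ → (k + 2 ≤ lam j + j ↔ j ≤ Dpart ℓ lam (k + 1)) := by
    intro j h1 h2
    rw [Dpart_of_le hk]
    refine iff_le_card_filter_Icc (p := fun j => k + 2 ≤ lam j + j) ?_ h1 h2
    intro a b ha hab hb h
    have := strict_add_le hstrict ha hab hb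
    omega
  have hp := hpos i hi hiℓ
  rcases le_or_gt i (Dpart ℓ lam (k + 1)) with h | h
  · left
    have h1 := (key _ (by omega) hD).2 le_rfl
    have h2 := strict_add_le hstrict hi h hD
    omega
  · right
    have h1 := mt (key (Dpart ℓ lam (k + 1) + 1) (by omega) (by omega)).1 (by omega)
    have h2 := strict_add_le hstrict (i := Dpart ℓ lam (k + 1) + 1) (by omega) h hiℓ
    omega

/-- The leg length `λ_{i+1} - 1` for `i < ℓ`, followed by the remaining column indices. -/
def legIndex (ℓ : ℕ) (lam : ℕ → ℕ) (i : ℕ) : ℕ :=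
  if i < ℓ then lam (i + 1) - 1 else i - Dpart ℓ lam (i + 1)

theorem legIndex_lt {ℓ : ℕ} {lam : ℕ → ℕ} (hstrict : ∀ i, 1 ≤ i → i < ℓ → lam (i + 1) < lam i)
    {i : ℕ} (hi : i < lam 1 + ℓ + 1) : legIndex ℓ lam i < lam 1 + ℓ + 1 := by
  unfold legIndex
  split_ifs with h
  · have := strict_add_le hstrict (i := 1) (j := i + 1) le_rfl (by omega) h
    omega
  · omega

theorem legIndex_compare {ℓ : ℕ} {lam : ℕ → ℕ} (hpos : ∀ i, 1 ≤ i → i ≤ ℓ → 0 < lam i)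
    (hstrict : ∀ i, 1 ≤ i → i < ℓ → lam (i + 1) < lam i) {i j : ℕ} (hij : i < j) :
    (legIndex ℓ lam j < legIndex ℓ lam i ∧ (j < ℓ ∨ i < Dpart ℓ lam (j + 1))) ∨
      (legIndex ℓ lam i < legIndex ℓ lam j ∧ ℓ ≤ j ∧ Dpart ℓ lam (j + 1) ≤ i) := by
  unfold legIndex
  rcases lt_or_ge j ℓ with hj | hj
  · have := strict_add_le hstrict (i := i + 1) (j := j + 1) (by omega) (by omega) hj
    have := hpos (j + 1) (by omega) (by omega)
    rw [if_pos (by omega), if_pos (by omega)]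
    omega
  · rw [if_neg (by omega : ¬ j < ℓ)]
    rcases lt_or_ge i ℓ with hi | hi
    · have := lt_iff_le_Dpart hpos hstrict hj (i := i + 1) (by omega) hi
      rw [if_pos hi]
      omega
    · have := Dpart_antitone (lam := lam) hi hij.le
      have := Dpart_le (lam := lam) hj
      have := Dpart_le (lam := lam) hi
      rw [if_neg (by omega)]
      omega

theorem legIndex_injective {ℓ : ℕ} {lam : ℕ → ℕ} (hpos : ∀ i, 1 ≤ i → i ≤ ℓ → 0 < lam i)
    (hstrict : ∀ i, 1 ≤ i → i < ℓ → lam (i + 1) < lam i) :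
    Function.Injective (legIndex ℓ lam) := by
  intro i j h
  rcases lt_trichotomy i j with hij | hij | hij
  · have := legIndex_compare hpos hstrict hij
    omega
  · exact hij
  · have := legIndex_compare hpos hstrict hij
    omega

theorem sign_eq_of_legIndex {ℓ : ℕ} {lam : ℕ → ℕ} (hpos : ∀ i, 1 ≤ i → i ≤ ℓ → 0 < lam i)
    (hstrict : ∀ i, 1 ≤ i → i < ℓ → lam (i + 1) < lam i)
    (π : Equiv.Perm (Fin (lam 1 + ℓ + 1))) (hπ : ∀ i, (π i : ℕ) = legIndex ℓ lam i) :
    Equiv.Perm.sign π = ∏ j : Fin ℓ, (-1) ^ (lam (j + 1) - 1) := by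
  have h1 : ∀ j : Fin (lam 1 + ℓ + 1),
      (∏ i ∈ Finset.Iio j, (if π i < π j then 1 else -1 : ℤˣ)) =
        (-1) ^ (j : ℕ) * (-1) ^ (π j : ℕ) * if (j : ℕ) < ℓ then (-1) ^ (lam (j + 1) - 1) else 1 := by
    intro j
    rw [Finset.prod_ite, Finset.prod_const_one, one_mul, Finset.prod_const]
    have hc : ∀ i : Fin (lam 1 + ℓ + 1), i ∈ Finset.Iio j → (¬ π i < π j ↔ (j : ℕ) < ℓ ∨ (i : ℕ) < Dpart ℓ lam (j + 1)) := by
      intro i hi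
      have := legIndex_compare hpos hstrict (Fin.lt_def.1 (Finset.mem_Iio.1 hi))
      rw [Fin.lt_def, hπ, hπ]
      omega
    rw [Finset.filter_congr hc, hπ]
    unfold legIndex
    split_ifs with hj
    · rw [Finset.filter_true_of_mem (by simp [hj]), Fin.card_Iio, mul_assoc, ← pow_add, ← two_mul,
        pow_mul]
      simp
    · have hD := Dpart_le (lam := lam) (not_lt.1 hj)
      have hs : (Finset.Iio j).filter (fun i : Fin (lam 1 + ℓ + 1) => (j : ℕ) < ℓ ∨ (i : ℕ) < Dpart ℓ lam (j + 1)) =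
          Finset.Iio ⟨Dpart ℓ lam (j + 1), by omega⟩ := by
        ext i
        simp only [Finset.mem_filter, Finset.mem_Iio, Fin.lt_def]
        omega
      rw [hs, Fin.card_Iio, mul_one, ← pow_add]
      have : (j : ℕ) + (j - Dpart ℓ lam (j + 1)) =
          2 * (j - Dpart ℓ lam (j + 1)) + Dpart ℓ lam (j + 1) := by omega
      simp only [this, pow_add, pow_mul]
      simp
  rw [Equiv.Perm.sign_eq_prod_prod_Iio, Finset.prod_congr rfl fun j _ => h1 j,
    Finset.prod_mul_distrib, Finset.prod_mul_distrib,
    Equiv.prod_comp π fun j : Fin (lam 1 + ℓ + 1) => (-1 : ℤˣ) ^ (j : ℕ), Int.units_mul_self, one_mul,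
    Fin.prod_univ_eq_prod_range (fun j => if j < ℓ then (-1 : ℤˣ) ^ (lam (j + 1) - 1) else 1),
    Fin.prod_univ_eq_prod_range (fun j => (-1 : ℤˣ) ^ (lam (j + 1) - 1)), ← Finset.prod_filter]
  congr 1
  ext j
  simp only [Finset.mem_filter, Finset.mem_range]
  omega

/-- The unitriangular Toeplitz matrix with entries `(-1)^(j-i) q_{j-i}`. -/
noncomputable def qToeplitz (N : ℕ) : Matrix (Fin N) (Fin N) SymFn :=
  Matrix.of fun j k => if (j : ℕ) ≤ k then (-1) ^ ((k : ℕ) - j) * qfun (k - j) else 0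

theorem det_qToeplitz (N : ℕ) : (qToeplitz N).det = 1 := by
  rw [Matrix.det_of_isUpperTriangular]
  · simp [qToeplitz, qfun]
  · intro i j hij
    have : ¬ (i : ℕ) ≤ j := not_le.2 hij
    rw [qToeplitz, Matrix.of_apply, if_neg this]

theorem sum_mul_qToeplitz {N : ℕ} (f : ℕ → SymFn) (k : Fin N) :
    ∑ j : Fin N, f j * qToeplitz N j k =
      ∑ j ∈ Finset.range (k + 1), f j * ((-1) ^ ((k : ℕ) - j) * qfun (k - j)) := by
  simp only [qToeplitz, Matrix.of_apply]
  rw [Fin.sum_univ_eq_sum_range (fun j => f j *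
    (if j ≤ (k : ℕ) then (-1) ^ ((k : ℕ) - j) * qfun (k - j) else 0))]
  simp only [mul_ite, mul_zero]
  rw [← Finset.sum_filter]
  refine Finset.sum_congr ?_ fun _ _ => rfl
  ext j
  simp only [Finset.mem_filter, Finset.mem_range]
  omega

theorem sum_qz_sub_mul (c k : ℕ) :
    ∑ j ∈ Finset.range (k + 1), qz ((j : ℤ) - c) * ((-1) ^ (k - j) * qfun (k - j)) =
      if k = c then 1 else 0 := by
  have hneg : ∀ j, j < c → qz ((j : ℤ) - c) = 0 := fun j hj => if_neg (by omega)
  rcases lt_or_ge k c with h | h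
  · rw [if_neg (by omega)]
    refine Finset.sum_eq_zero fun j hj => ?_
    rw [hneg j (by have := Finset.mem_range.1 hj; omega), zero_mul]
  · have h1 : k + 1 = c + (k - c + 1) := by omega
    rw [h1, Finset.sum_range_add, Finset.sum_eq_zero (fun j hj => by
      rw [hneg j (Finset.mem_range.1 hj), zero_mul]), zero_add]
    have h2 := sum_qfun_mul_neg_one_pow_qfun (k - c)
    simp only [show k = c ↔ k - c = 0 by omega, ← h2]
    refine Finset.sum_congr rfl fun t _ => ?_
    rw [show ((c + t : ℕ) : ℤ) - c = (t : ℕ) by push_cast; ring, qz_natCast,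
      show k - (c + t) = k - c - t by omega]
    ring

theorem two_pow_mul_phi_schurD {ℓ : ℕ} {lam : ℕ → ℕ} (hpos : ∀ i, 1 ≤ i → i ≤ ℓ → 0 < lam i)
    (hstrict : ∀ i, 1 ≤ i → i < ℓ → lam (i + 1) < lam i) :
    2 ^ ℓ * phi (schurD ℓ lam) = (Matrix.of fun i j : Fin ℓ =>
      qfun (lam (i + 1)) * qfun (lam (j + 1)) - Qpair (lam (i + 1)) (lam (j + 1))).det := by
  let N := lam 1 + ℓ + 1
  let π : Equiv.Perm (Fin N) := Equiv.ofBijective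
    (fun i => ⟨legIndex ℓ lam i, legIndex_lt hstrict i.isLt⟩)
    (Finite.injective_iff_bijective.1 fun i j h =>
      Fin.ext (legIndex_injective hpos hstrict (congrArg Fin.val h)))
  have hπ : ∀ i, (π i : ℕ) = legIndex ℓ lam i := fun i => rfl
  let H : Matrix (Fin N) (Fin N) SymFn :=
    Matrix.of fun i j => qz ((Dpart ℓ lam (i + 1) : ℤ) + (j : ℤ) - (i : ℤ))
  let B := H * qToeplitz N
  have hH : phi (schurD ℓ lam) = B.det := by
    rw [schurD, AlgHom.map_det, Matrix.det_mul, det_qToeplitz, mul_one]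
    congr 1
    ext1 i j
    simp [H, phi_hz]
  have hB : ∀ i k, B i k = ∑ j ∈ Finset.range (k + 1),
      qz ((Dpart ℓ lam (i + 1) : ℤ) + (j : ℤ) - (i : ℤ)) *
        ((-1) ^ ((k : ℕ) - j) * qfun (k - j)) := fun i k => by
    rw [← sum_mul_qToeplitz fun j => qz ((Dpart ℓ lam (i + 1) : ℤ) + (j : ℤ) - (i : ℤ))]
    exact Matrix.mul_apply
  have hB1 : ∀ i k : Fin N, ¬ (i : ℕ) < ℓ → B i k = if k = π i then 1 else 0 := fun i k hi => by
    have hD := Dpart_le (lam := lam) (not_lt.1 hi)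
    have hc := sum_qz_sub_mul (π i) k
    simp only [Fin.ext_iff]
    rw [hB, ← hc]
    refine Finset.sum_congr rfl fun j _ => ?_
    rw [hπ, legIndex, if_neg hi, Nat.cast_sub (by omega)]
    congr 2
    ring
  have hB2 : ∀ i k : Fin N, (i : ℕ) < ℓ → B i k = ∑ j ∈ Finset.range (k + 1),
      qfun (lam (i + 1) + 1 + j) * ((-1) ^ ((k : ℕ) - j) * qfun (k - j)) := fun i k hi => by
    rw [hB]
    refine Finset.sum_congr rfl fun j _ => ?_
    rw [Dpart, if_neg (by omega), if_pos (by omega), ← qz_natCast (_ + 1 + j)]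
    congr 2
    push_cast
    ring
  let p : Fin N → Prop := fun i => (i : ℕ) < ℓ
  let e : Fin ℓ ≃ {i : Fin N // p i} :=
    { toFun i := ⟨⟨i, by have := i.isLt; omega⟩, i.isLt⟩
      invFun i := ⟨i.1, i.2⟩
      left_inv _ := rfl
      right_inv _ := rfl }
  have hdet := Matrix.twoBlockTriangular_det (B.submatrix id π) p (fun i hi j hj => by
    rw [Matrix.submatrix_apply, id, hB1 i _ hi, if_neg]
    rintro h
    exact hi (π.injective h ▸ hj))
  have h1 : (Matrix.toSquareBlockProp (B.submatrix id π) fun i => ¬ p i) = 1 := by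
    ext1 i j
    rw [Matrix.toSquareBlockProp_def, Matrix.of_apply, Matrix.submatrix_apply, id,
      hB1 _ _ i.2, Matrix.one_apply]
    simp [eq_comm, Subtype.ext_iff]
  rw [h1, Matrix.det_one, mul_one, Matrix.det_permute', sign_eq_of_legIndex hpos hstrict π hπ,
    ← Matrix.det_submatrix_equiv_self e] at hdet
  have h2 : (2 : SymFn) ^ ℓ * ((Matrix.toSquareBlockProp (B.submatrix id π) p).submatrix e e).det =
      (∏ j : Fin ℓ, (-1) ^ (lam (j + 1) - 1)) * (Matrix.of fun i j : Fin ℓ =>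
      qfun (lam (i + 1)) * qfun (lam (j + 1)) - Qpair (lam (i + 1)) (lam (j + 1))).det := by
    rw [← Matrix.det_mul_row]
    have hs := Matrix.det_smul
      ((Matrix.toSquareBlockProp (B.submatrix id π) p).submatrix e e) (2 : SymFn)
    rw [Fintype.card_fin] at hs
    rw [← hs]
    congr 1
    ext1 i j
    have hj := hpos (j + 1) (by omega) (by omega)
    rw [Matrix.smul_apply, Matrix.submatrix_apply, Matrix.toSquareBlockProp_def, Matrix.of_apply,
      Matrix.submatrix_apply, id, hB2 _ _ (e i).2, hπ]
    have hleg : legIndex ℓ lam (e j).1 = lam (j + 1) - 1 := if_pos (e j).2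
    rw [hleg, Nat.sub_add_cancel hj, smul_eq_mul]
    exact two_mul_sum_hook hj
  have h3 : (∏ j : Fin ℓ, (-1 : SymFn) ^ (lam (j + 1) - 1)) *
      ∏ j : Fin ℓ, (-1 : SymFn) ^ (lam (j + 1) - 1) = 1 := by
    rw [← Finset.prod_mul_distrib]
    exact Finset.prod_eq_one fun j _ => by rw [← mul_pow]; simp
  rw [← hdet] at h2
  push_cast at h2
  rw [hH]
  linear_combination (∏ j : Fin ℓ, (-1 : SymFn) ^ (lam (j + 1) - 1)) * h2 -
    (2 ^ ℓ * B.det - (Matrix.of fun i j : Fin ℓ =>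
      qfun (lam (i + 1)) * qfun (lam (j + 1)) - Qpair (lam (i + 1)) (lam (j + 1))).det) * h3

/-- The antisymmetric array whose Pfaffian is a Schur `Q`-function. -/
noncomputable def qAlt (lam : ℕ → ℕ) (i j : ℕ) : SymFn :=
  if i < j then Qpair (lam (i + 1)) (lam (j + 1))
  else if j < i then -Qpair (lam (j + 1)) (lam (i + 1))
  else 0

theorem qAlt_self (lam : ℕ → ℕ) (i : ℕ) : qAlt lam i i = 0 := by simp [qAlt]

theorem qAlt_antisymm (lam : ℕ → ℕ) (i j : ℕ) : qAlt lam i j = -qAlt lam j i := by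
  unfold qAlt
  rcases lt_trichotomy i j with h | rfl | h
  · simp [h, h.not_gt]
  · simp
  · simp [h, h.not_gt]

theorem qAlt_eq_Qpair {lam : ℕ → ℕ} {i j : ℕ} (h : lam (i + 1) + lam (j + 1) ≠ 0) :
    qAlt lam i j = Qpair (lam (i + 1)) (lam (j + 1)) := by
  unfold qAlt
  rcases lt_trichotomy i j with hij | rfl | hij
  · rw [if_pos hij]
  · rw [if_neg (lt_irrefl i), if_neg (lt_irrefl i), Qpair_self (by omega)]
  · rw [if_neg hij.not_gt, if_pos hij, ← Qpair_antisymm h]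

theorem schurQ_mul_self {ℓ : ℕ} (hℓ : ℓ ≠ 0) (lam : ℕ → ℕ) :
    schurQ ℓ lam * schurQ ℓ lam =
      (Matrix.of fun i j : Fin (2 * ((ℓ + 1) / 2)) => qAlt lam i j).det := by
  have h := pfaffianSum_sq (Matrix.of fun i j : Fin (2 * ((ℓ + 1) / 2)) => qAlt lam i j)
    (fun a => qAlt_self lam a) (fun a b => qAlt_antisymm lam a b)
  have hc : ((2 ^ ((ℓ + 1) / 2) * ((ℓ + 1) / 2).factorial : ℕ) : SymFn) =
      algebraMap ℚ SymFn (2 ^ ((ℓ + 1) / 2) * ((ℓ + 1) / 2).factorial : ℚ) := by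
    simp only [map_mul, map_pow, map_natCast, map_ofNat, Nat.cast_mul, Nat.cast_pow, Nat.cast_ofNat]
  have hne : (2 ^ ((ℓ + 1) / 2) * ((ℓ + 1) / 2).factorial : ℚ) ≠ 0 := by positivity
  rw [hc, sq, ← map_pow] at h
  rw [schurQ, if_neg hℓ]
  dsimp only
  rw [smul_mul_smul_comm]
  refine (congrArg _ h).trans ?_
  rw [← Algebra.smul_def, smul_smul, ← mul_inv, sq, inv_mul_cancel₀ (mul_ne_zero hne hne), one_smul]

theorem det_sub_eq_add_det {R : Type*} [CommRing R] {n : ℕ} (A : Matrix (Fin n) (Fin n) R)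
    (ha : ∀ i j, A i j = -A j i) (q : Fin n → R) (C : Matrix (Fin (n + 1)) (Fin (n + 1)) R)
    (hC : ∀ i j : Fin n, C i.castSucc j.castSucc = A i j)
    (hr : ∀ i : Fin n, C i.castSucc (Fin.last n) = q i)
    (hl : ∀ i : Fin n, C (Fin.last n) i.castSucc = -q i) (h0 : C (Fin.last n) (Fin.last n) = 0) :
    (Matrix.of fun i j => q i * q j - A i j).det = A.det + C.det := by
  let M : R → Matrix (Fin n ⊕ Fin 1) (Fin n ⊕ Fin 1) R := fun t =>
    Matrix.fromBlocks A (Matrix.of fun i _ => q i) (Matrix.of fun _ j => -q j) (Matrix.of fun _ _ => t)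
  have h1 : (M 1).det = (Matrix.of fun i j => q i * q j - A i j).det := by
    have hone : (Matrix.of fun _ _ => 1 : Matrix (Fin 1) (Fin 1) R) = 1 := by
      ext i j
      rw [Subsingleton.elim i j, Matrix.of_apply, Matrix.one_apply_eq]
    simp only [M]
    rw [hone, Matrix.det_fromBlocks_one₂₂, ← Matrix.det_transpose]
    congr 1
    ext i j
    simp [Matrix.mul_apply, ha i j]
    ring
  have h2 : (M 0).det = C.det := by
    rw [← Matrix.det_submatrix_equiv_self finSumFinEquiv C]
    congr 1
    ext i j
    rcases i with i | i <;> rcases j with j | j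
    · exact (hC i j).symm
    · obtain rfl := Subsingleton.elim j 0
      exact (hr i).symm
    · obtain rfl := Subsingleton.elim i 0
      exact (hl j).symm
    · obtain rfl := Subsingleton.elim i 0
      obtain rfl := Subsingleton.elim j 0
      exact h0.symm
  have h3 : (M 1).det = (M 0).det + A.det := by
    let v : Fin n ⊕ Fin 1 → R := Sum.elim (fun _ => 0) fun _ => 1
    have hu : M 1 = (M 0).updateRow (Sum.inr 0) (M 0 (Sum.inr 0) + v) := by
      ext i j
      rcases i with i | i <;> rcases j with j | j <;>
        simp [M, v, Matrix.updateRow_apply, Subsingleton.elim _ (0 : Fin 1)]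
    have hv : (M 0).updateRow (Sum.inr 0) v =
        Matrix.fromBlocks A (Matrix.of fun i _ => q i) 0 1 := by
      ext i j
      rcases i with i | i <;> rcases j with j | j <;>
        simp [M, v, Matrix.updateRow_apply, Subsingleton.elim _ (0 : Fin 1)]
    rw [hu, Matrix.det_updateRow_add, Matrix.updateRow_eq_self, hv, Matrix.det_fromBlocks_zero₂₁,
      Matrix.det_one, mul_one]
  rw [← h1, h3, h2, add_comm]

theorem det_qfun_mul_sub_Qpair {ℓ : ℕ} (hℓ : ℓ ≠ 0) {lam : ℕ → ℕ}
    (hpos : ∀ i, 1 ≤ i → i ≤ ℓ → 0 < lam i) (hzero : ∀ i, ℓ < i → lam i = 0) :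
    (Matrix.of fun i j : Fin ℓ =>
      qfun (lam (i + 1)) * qfun (lam (j + 1)) - Qpair (lam (i + 1)) (lam (j + 1))).det =
      schurQ ℓ lam * schurQ ℓ lam := by
  have hq : ∀ i : Fin ℓ, qAlt lam i ℓ = qfun (lam (i + 1)) := fun i => by
    rw [qAlt, if_pos i.isLt, hzero (ℓ + 1) (by omega), Qpair_zero_right]
  have h := det_sub_eq_add_det (Matrix.of fun i j : Fin ℓ => qAlt lam i j)
    (fun i j => qAlt_antisymm lam i j) (fun i => qfun (lam (i + 1)))
    (Matrix.of fun i j : Fin (ℓ + 1) => qAlt lam i j) (fun i j => rfl) hq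
    (fun i => (qAlt_antisymm lam ℓ i).trans (congrArg _ (hq i))) (qAlt_self lam ℓ)
  have hA : (Matrix.of fun i j : Fin ℓ =>
      qfun (lam (i + 1)) * qfun (lam (j + 1)) - Qpair (lam (i + 1)) (lam (j + 1))) =
      Matrix.of fun i j : Fin ℓ => qfun (lam (i + 1)) * qfun (lam (j + 1)) -
        (Matrix.of fun i j : Fin ℓ => qAlt lam i j) i j := by
    ext1 i j
    have := hpos (i + 1) (by omega) (by omega)
    simp only [Matrix.of_apply]
    rw [qAlt_eq_Qpair (by omega)]
  rw [hA, h, schurQ_mul_self hℓ]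
  rcases Nat.even_or_odd ℓ with he | ho
  · rw [det_eq_zero_of_antisymm_of_odd he.add_one (Matrix.of fun i j : Fin (ℓ + 1) => qAlt lam i j)
      (fun i j => qAlt_antisymm lam i j), add_zero, show 2 * ((ℓ + 1) / 2) = ℓ by grind]
  · rw [det_eq_zero_of_antisymm_of_odd ho (Matrix.of fun i j : Fin ℓ => qAlt lam i j)
      (fun i j => qAlt_antisymm lam i j), zero_add, show 2 * ((ℓ + 1) / 2) = ℓ + 1 by grind]

/-- Macdonald III.8 Ex. 10: for every strict partition `λ` (of `n`, with `ℓ` parts),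
`φ(s_{D(λ)}) = 2^{-ℓ(λ)} (Q_λ)²`. -/
theorem phi_schur_double (ℓ n : ℕ) (lam : ℕ → ℕ)
    (hpos : ∀ i, 1 ≤ i → i ≤ ℓ → 0 < lam i)
    (hstrict : ∀ i, 1 ≤ i → i < ℓ → lam (i + 1) < lam i)
    (hzero : ∀ i, ℓ < i → lam i = 0)
    (hsum : ∑ i ∈ Finset.Icc 1 ℓ, lam i = n) :
    phi (schurD ℓ lam) = ((2 : ℚ) ^ ℓ)⁻¹ • (schurQ ℓ lam * schurQ ℓ lam) := by
  have h := two_pow_mul_phi_schurD hpos hstrict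
  have hQ : 2 ^ ℓ * phi (schurD ℓ lam) = schurQ ℓ lam * schurQ ℓ lam := by
    rcases eq_or_ne ℓ 0 with rfl | hℓ
    · rw [h, schurQ, if_pos rfl, Matrix.det_isEmpty, mul_one]
    · rw [h, det_qfun_mul_sub_Qpair hℓ hpos hzero]
  have hc : (2 : SymFn) ^ ℓ = algebraMap ℚ SymFn (2 ^ ℓ) := by rw [map_pow, map_ofNat]
  rw [← hQ, hc, ← Algebra.smul_def, smul_smul, inv_mul_cancel₀ (by positivity), one_smul]
end

section
/- Let λ be a strict partition of n, f^{D(λ)} the number of standard Young tableaux of shape D(λ), and g^λ the number of standard shifted Young tableaux of shape λ. Then f^{D(λ)} / (2n)! = 2^{-ℓ(λ)} · (g^λ / n!)², where ℓ(λ) is the number of parts of λ. -/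
/-- The set of cells of the double `D(λ)` of a strict partition `λ` (given by its
length `ℓ` and parts `lam 1 > lam 2 > ⋯ > lam ℓ`). -/
def doubleDiagram (ℓ : ℕ) (lam : ℕ → ℕ) : Finset (ℕ × ℕ) :=
  (Finset.Icc 1 ℓ).biUnion fun i =>
    ((Finset.Icc i (i + lam i - 1)).image fun j => (i, j)) ∪
      ((Finset.Icc (i + 1) (i + lam i)).image fun j => (j, i))

/-- The shifted Young diagram of a strict partition `λ`: row `i` consists of the
cells `(i, j)` for `i ≤ j ≤ i + λ_i - 1`. -/
def shiftedDiagram (ℓ : ℕ) (lam : ℕ → ℕ) : Finset (ℕ × ℕ) :=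
  (Finset.Icc 1 ℓ).biUnion fun i =>
    (Finset.Icc i (i + lam i - 1)).image fun j => (i, j)

/-- The number of standard Young tableaux of shape a given cell set `D`: bijective
fillings of the cells of `D` by `1, …, |D|` which increase along rows and columns. -/
noncomputable def numSYT (D : Finset (ℕ × ℕ)) : ℕ :=
  Nat.card {T : {c // c ∈ D} → Fin D.card //
    Function.Bijective T ∧ ∀ a b : {c // c ∈ D},
      ((a.1.1 = b.1.1 ∧ a.1.2 < b.1.2) ∨ (a.1.2 = b.1.2 ∧ a.1.1 < b.1.1)) → T a < T b}

open Finset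

/-- Cell `b` lies in the same row to the right of `a`, or in the same column below `a`. -/
def CellBefore (a b : ℕ × ℕ) : Prop :=
  (a.1 = b.1 ∧ a.2 < b.2) ∨ (a.2 = b.2 ∧ a.1 < b.1)

instance : DecidableRel CellBefore := fun _ _ => inferInstanceAs (Decidable (_ ∨ _))

/-- The cells of `D` that have no cell of `D` to the right of or below them. -/
def corners (D : Finset (ℕ × ℕ)) : Finset (ℕ × ℕ) :=
  {c ∈ D | ∀ b ∈ D, ¬ CellBefore c b}

/-- Standard fillings of `D` by `0, …, |D| - 1`, extended by zero outside `D`. -/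
def standardFillings (D : Finset (ℕ × ℕ)) : Set (ℕ × ℕ → ℕ) :=
  {T | (∀ c ∉ D, T c = 0) ∧ (∀ c ∈ D, T c < #D) ∧ Set.InjOn T D ∧
    ∀ a ∈ D, ∀ b ∈ D, CellBefore a b → T a < T b}

theorem mem_corners {D : Finset (ℕ × ℕ)} {c : ℕ × ℕ} :
    c ∈ corners D ↔ c ∈ D ∧ ∀ b ∈ D, ¬ CellBefore c b := by
  simp [corners]

theorem standardFillings_finite (D : Finset (ℕ × ℕ)) : (standardFillings D).Finite := by
  have h : (Set.univ : Set (D → Fin (#D))).Finite := Set.finite_univ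
  refine (h.image fun f c => if hc : c ∈ D then (f ⟨c, hc⟩ : ℕ) else 0).subset ?_
  rintro T ⟨h0, h1, -, -⟩
  refine ⟨fun c => ⟨T c, h1 c c.2⟩, trivial, ?_⟩
  funext c
  by_cases hc : c ∈ D
  · simp [hc]
  · simp [hc, h0 c hc]

theorem numSYT_eq_ncard (D : Finset (ℕ × ℕ)) : numSYT D = (standardFillings D).ncard := by
  rw [numSYT, ← Nat.card_coe_set_eq]
  refine Nat.card_congr
    { toFun := fun T => ⟨fun c => if hc : c ∈ D then (T.1 ⟨c, hc⟩ : ℕ) else 0, ?_, ?_, ?_, ?_⟩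
      invFun := fun T => ⟨fun c => ⟨T.1 c, T.2.2.1 c c.2⟩, ?_, ?_⟩
      left_inv := ?_
      right_inv := ?_ }
  · intro c hc
    simp [hc]
  · intro c hc
    simp [hc]
  · intro a ha b hb hab
    simp only [mem_coe] at ha hb
    simp only [ha, hb, dite_true] at hab
    simpa using T.2.1.1 (Fin.ext hab)
  · intro a ha b hb hab
    simpa [ha, hb] using T.2.2 ⟨a, ha⟩ ⟨b, hb⟩ hab
  · rw [Fintype.bijective_iff_injective_and_card]
    refine ⟨fun a b hab => ?_, by simp⟩
    exact Subtype.ext (T.2.2.2.1 a.2 b.2 (by simpa using hab))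
  · intro a b hab
    exact T.2.2.2.2 a a.2 b b.2 hab
  · intro T
    ext c
    simp
  · rintro ⟨T, h0, _⟩
    ext c
    by_cases hc : c ∈ D
    · simp [hc]
    · simp [hc, h0 c hc]

theorem standardFillings_eq_iUnion {D : Finset (ℕ × ℕ)} (hD : D.Nonempty) :
    standardFillings D = ⋃ c ∈ corners D,
      (fun T => Function.update T c (#D - 1)) '' standardFillings (D.erase c) := by
  have hpos : 0 < #D := hD.card_pos
  ext T
  simp only [Set.mem_iUnion, Set.mem_image, exists_prop, mem_corners]
  constructor
  · rintro ⟨h0, h1, h2, h3⟩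
    have hsurj := surjOn_of_injOn_of_card_le (s := D) (t := range #D) T
      (fun c hc => by simpa using h1 c hc) h2 (by simp)
    obtain ⟨c, hc, hTc⟩ := hsurj (by simpa using hpos : #D - 1 ∈ (range #D : Set ℕ))
    have hc' : c ∈ D := hc
    refine ⟨c, ⟨hc', fun b hb hcb => ?_⟩, Function.update T c 0, ⟨?_, ?_, ?_, ?_⟩, ?_⟩
    · have := h3 c hc b hb hcb
      have := h1 b hb
      omega
    · intro b hb
      by_cases hbc : b = c
      · simp [hbc]
      · simp [hbc, h0 b (by simpa [hbc] using hb)]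
    · intro b hb
      obtain ⟨hbc, hbD⟩ := mem_erase.1 hb
      rw [Function.update_of_ne hbc, card_erase_of_mem hc]
      have h4 := h1 b hbD
      have h5 : T b ≠ T c := fun h => hbc (h2 hbD hc h)
      omega
    · intro a ha b hb hab
      obtain ⟨hac, haD⟩ := mem_erase.1 (mem_coe.1 ha)
      obtain ⟨hbc, hbD⟩ := mem_erase.1 (mem_coe.1 hb)
      rw [Function.update_of_ne hac, Function.update_of_ne hbc] at hab
      exact h2 haD hbD hab
    · intro a ha b hb hab
      obtain ⟨hac, haD⟩ := mem_erase.1 ha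
      obtain ⟨hbc, hbD⟩ := mem_erase.1 hb
      rw [Function.update_of_ne hac, Function.update_of_ne hbc]
      exact h3 a haD b hbD hab
    · simp [← hTc]
  · rintro ⟨c, ⟨hc, hmax⟩, T, ⟨h0, h1, h2, h3⟩, rfl⟩
    rw [card_erase_of_mem hc] at h1
    refine ⟨?_, ?_, ?_, ?_⟩
    · intro b hb
      have hbc : b ≠ c := fun h => hb (h ▸ hc)
      simp [hbc, h0 b (fun h => hb (mem_of_mem_erase h))]
    · intro b hb
      by_cases hbc : b = c
      · simp [hbc, hpos]
      · have := h1 b (mem_erase.2 ⟨hbc, hb⟩)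
        simp only [Function.update_of_ne hbc]
        omega
    · intro a ha b hb hab
      by_cases hac : a = c <;> by_cases hbc : b = c
      · rw [hac, hbc]
      · have := h1 b (mem_erase.2 ⟨hbc, hb⟩)
        simp only [hac, Function.update_self, Function.update_of_ne hbc] at hab
        omega
      · have := h1 a (mem_erase.2 ⟨hac, ha⟩)
        simp only [hbc, Function.update_self, Function.update_of_ne hac] at hab
        omega
      · simp only [Function.update_of_ne hac, Function.update_of_ne hbc] at hab
        exact h2 (mem_erase.2 ⟨hac, ha⟩) (mem_erase.2 ⟨hbc, hb⟩) hab
    · intro a ha b hb hab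
      have hac : a ≠ c := fun h => hmax b hb (h ▸ hab)
      by_cases hbc : b = c
      · simpa [hbc, hac] using h1 a (mem_erase.2 ⟨hac, ha⟩)
      · simpa [hbc, hac] using h3 a (mem_erase.2 ⟨hac, ha⟩) b (mem_erase.2 ⟨hbc, hb⟩) hab

theorem update_injOn_standardFillings_erase (D : Finset (ℕ × ℕ)) (c : ℕ × ℕ) (m : ℕ) :
    Set.InjOn (fun T => Function.update T c m) (standardFillings (D.erase c)) := by
  intro T hT T' hT' h
  funext b
  by_cases hbc : b = c
  · rw [hT.1 b (by simp [hbc]), hT'.1 b (by simp [hbc])]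
  · simpa [hbc] using congrFun h b

theorem numSYT_eq_sum_corners {D : Finset (ℕ × ℕ)} (hD : D.Nonempty) :
    numSYT D = ∑ c ∈ corners D, numSYT (D.erase c) := by
  classical
  have hfin : ∀ c, ((fun T => Function.update T c (#D - 1)) ''
      standardFillings (D.erase c)).Finite := fun c => (standardFillings_finite _).image _
  have hU : standardFillings D = ((corners D).biUnion fun c => (hfin c).toFinset : Finset _) := by
    rw [standardFillings_eq_iUnion hD]
    simp
  rw [numSYT_eq_ncard, hU, Set.ncard_coe_finset, card_biUnion]
  · refine sum_congr rfl fun c _ => ?_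
    rw [numSYT_eq_ncard, ← Set.ncard_eq_toFinset_card _ (hfin c),
      (update_injOn_standardFillings_erase D c _).ncard_image]
  · intro c hc c' hc' hne
    rw [Function.onFun, disjoint_left]
    simp only [Set.Finite.mem_toFinset, Set.mem_image]
    rintro _ ⟨T, hT, rfl⟩ ⟨T', hT', h⟩
    have h1 := congrFun h c
    have h2 := hT'.2.1 c (mem_erase.2 ⟨hne, (mem_corners.1 hc).1⟩)
    rw [card_erase_of_mem (mem_corners.1 hc').1] at h2
    simp only [Function.update_self, Function.update_of_ne hne] at h1
    omega

/-- The probability that a uniformly random filling of `D` is standard. -/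
noncomputable def sytDensity (D : Finset (ℕ × ℕ)) : ℚ := numSYT D / (#D).factorial

theorem sytDensity_empty : sytDensity ∅ = 1 := by
  have h : standardFillings ∅ = {fun _ => 0} := by
    ext T
    simp [standardFillings, funext_iff]
  simp [sytDensity, numSYT_eq_ncard, h]

theorem card_mul_sytDensity {D : Finset (ℕ × ℕ)} (hD : D.Nonempty) :
    (#D : ℚ) * sytDensity D = ∑ c ∈ corners D, sytDensity (D.erase c) := by
  obtain ⟨m, hm⟩ : ∃ m, #D = m + 1 := Nat.exists_eq_succ_of_ne_zero hD.card_pos.ne'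
  have h : ∀ c ∈ corners D, sytDensity (D.erase c) = numSYT (D.erase c) / m.factorial := by
    intro c hc
    rw [sytDensity, card_erase_of_mem (mem_corners.1 hc).1, hm, Nat.add_sub_cancel]
  rw [sum_congr rfl h, ← sum_div, sytDensity, numSYT_eq_sum_corners hD, hm, Nat.factorial_succ]
  push_cast
  have := Nat.cast_ne_zero (R := ℚ).2 m.factorial_ne_zero
  have : (m : ℚ) + 1 ≠ 0 := by positivity
  field_simp

theorem sum_mul_prod_shifted_ratio {ι K : Type*} [Field K] [CharZero K] [DecidableEq ι]
    (s : Finset ι) (x : ι → K) (hx : Set.InjOn (fun i => x i ^ 2 - x i) s) :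
    ∑ i ∈ s, x i * ∏ j ∈ s.erase i,
      ((x i - 1 - x j) / (x i - 1 + x j)) / ((x i - x j) / (x i + x j)) = ∑ i ∈ s, x i := by
  open Polynomial in
  rcases s.eq_empty_or_nonempty with rfl | hs
  · simp
  set y : ι → K := fun i => x i ^ 2 - x i with hy
  set z : ι → K := fun i => x i ^ 2 + x i with hz
  set P : K[X] := ∏ i ∈ s, (X - C (z i)) - ∏ i ∈ s, (X - C (y i)) with hP
  have hdeg : ∀ v : ι → K, (∏ i ∈ s, (X - C (v i))).degree = ((#s : ℕ) : WithBot ℕ) := fun v => by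
    simp [degree_prod]
  have hPdeg : P.degree < #s := by
    have hmonic : ∀ v : ι → K, (∏ i ∈ s, (X - C (v i))).leadingCoeff = 1 := fun v =>
      monic_prod_of_monic _ _ fun i _ => monic_X_sub_C _
    have := degree_sub_lt_left ((hdeg z).trans (hdeg y).symm)
      (monic_prod_of_monic _ _ fun i _ => monic_X_sub_C _).ne_zero
      ((hmonic z).trans (hmonic y).symm)
    rwa [hdeg] at this
  have hcoeff := Lagrange.coeff_eq_sum hx hPdeg
  have hlhs : P.coeff (#s - 1) = -2 * ∑ i ∈ s, x i := by
    rw [hP, coeff_sub, prod_X_sub_C_coeff_card_pred _ _ hs.card_pos,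
      prod_X_sub_C_coeff_card_pred _ _ hs.card_pos, hy, hz, sum_sub_distrib, sum_add_distrib]
    ring
  rw [hlhs] at hcoeff
  have hterm : ∀ i ∈ s, P.eval (y i) / ∏ j ∈ s.erase i, (y i - y j) =
      -2 * (x i * ∏ j ∈ s.erase i,
        ((x i - 1 - x j) / (x i - 1 + x j)) / ((x i - x j) / (x i + x j))) := by
    intro i hi
    have h0 : ∏ j ∈ s, (y i - y j) = 0 := prod_eq_zero hi (sub_self _)
    rw [hP, eval_sub, eval_prod, eval_prod]
    simp only [eval_sub, eval_X, eval_C]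
    rw [h0, sub_zero, ← mul_prod_erase s _ hi, mul_div_assoc, ← prod_div_distrib, ← mul_assoc]
    congr 1
    · simp only [hy, hz]
      ring
    · refine prod_congr rfl fun j hj => ?_
      rw [div_div_div_eq]
      congr 1 <;> simp only [hy, hz] <;> ring
  rw [sum_congr rfl hterm, ← mul_sum] at hcoeff
  exact (mul_left_cancel₀ (by norm_num) hcoeff).symm

/-- Schur's product `∏_{j < i < d} (x_j - x_i) / (x_j + x_i)`. -/
def schurProduct (d : ℕ) (x : ℕ → ℚ) : ℚ :=
  ∏ i ∈ range d, ∏ j ∈ range i, (x j - x i) / (x j + x i)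

theorem schurProduct_succ (d : ℕ) (x : ℕ → ℚ) :
    schurProduct (d + 1) x = schurProduct d x * ∏ j ∈ range d, (x j - x d) / (x j + x d) :=
  prod_range_succ _ _

theorem schurProduct_congr {d : ℕ} {x y : ℕ → ℚ} (h : ∀ i < d, x i = y i) :
    schurProduct d x = schurProduct d y := by
  refine prod_congr rfl fun i hi => prod_congr rfl fun j hj => ?_
  rw [mem_range] at hi hj
  rw [h i hi, h j (hj.trans hi)]

theorem schurProduct_update_mul {d k : ℕ} (hk : k < d) (x : ℕ → ℚ) (v : ℚ) :
    schurProduct d (Function.update x k v) *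
        ∏ j ∈ (range d).erase k, (x k - x j) / (x k + x j) =
      schurProduct d x * ∏ j ∈ (range d).erase k, (v - x j) / (v + x j) := by
  induction d with
  | zero => omega
  | succ d ih =>
    rw [schurProduct_succ, schurProduct_succ]
    rcases Nat.lt_succ_iff_lt_or_eq.1 hk with h | rfl
    · have hd : d ∉ (range d).erase k := by simp
      have hkd : d ≠ k := by omega
      have hmem : k ∈ range d := mem_range.2 h
      rw [range_add_one, erase_insert_of_ne hkd, prod_insert hd, prod_insert hd,
        ← mul_prod_erase _ _ hmem, ← mul_prod_erase _ (fun j => (x j - x d) / (x j + x d)) hmem]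
      have hcongr : ∏ j ∈ (range d).erase k,
          (Function.update x k v j - Function.update x k v d) /
            (Function.update x k v j + Function.update x k v d) =
          ∏ j ∈ (range d).erase k, (x j - x d) / (x j + x d) := by
        refine prod_congr rfl fun j hj => ?_
        rw [Function.update_of_ne (ne_of_mem_erase hj), Function.update_of_ne hkd]
      rw [hcongr, Function.update_self, Function.update_of_ne hkd]
      linear_combination ((v - x d) / (v + x d)) *
        (∏ j ∈ (range d).erase k, (x j - x d) / (x j + x d)) *
        ((x k - x d) / (x k + x d)) * ih h
    · have h1 : schurProduct k (Function.update x k v) = schurProduct k x :=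
        schurProduct_congr fun i hi => Function.update_of_ne hi.ne _ _
      have h2 : (range (k + 1)).erase k = range k := by
        ext j
        simp
        omega
      rw [h1, h2, mul_assoc, mul_assoc, ← prod_mul_distrib, ← prod_mul_distrib]
      congr 1
      refine prod_congr rfl fun j hj => ?_
      rw [Function.update_self, Function.update_of_ne (mem_range.1 hj).ne, ← neg_sub v,
        ← neg_sub (x j) (x k), add_comm v, add_comm (x k)]
      ring

/-- The product formula for the density of standard shifted tableaux of shape `x`. -/
def shiftedFormula (d : ℕ) (x : ℕ → ℕ) : ℚ :=
  (∏ i ∈ range d, ((x i).factorial : ℚ)⁻¹) * schurProduct d fun i => x i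

theorem shiftedFormula_succ (d : ℕ) (x : ℕ → ℕ) :
    shiftedFormula (d + 1) x = shiftedFormula d x * (((x d).factorial : ℚ)⁻¹ *
      ∏ j ∈ range d, ((x j : ℚ) - x d) / (x j + x d)) := by
  rw [shiftedFormula, shiftedFormula, schurProduct_succ, prod_range_succ]
  ring

theorem shiftedFormula_eq_zero {d i j : ℕ} {x : ℕ → ℕ} (hij : i < j) (hj : j < d)
    (h : x i = x j) : shiftedFormula d x = 0 := by
  refine mul_eq_zero_of_right _ (prod_eq_zero (mem_range.2 hj) (prod_eq_zero (mem_range.2 hij) ?_))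
  simp [h]

theorem shiftedFormula_update {d i : ℕ} {x : ℕ → ℕ} (hi : i < d)
    (hx : ∀ i j, i < j → j < d → x j < x i) (hpos : 0 < x i) :
    shiftedFormula d (Function.update x i (x i - 1)) =
      (x i * ∏ j ∈ (range d).erase i, (((x i : ℚ) - 1 - x j) / (x i - 1 + x j)) /
        (((x i : ℚ) - x j) / (x i + x j))) * shiftedFormula d x := by
  have hmem : i ∈ range d := mem_range.2 hi
  have hcast : (fun j => ((Function.update x i (x i - 1) j : ℕ) : ℚ)) =
      Function.update (fun j => (x j : ℚ)) i ((x i : ℚ) - 1) := by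
    funext j
    by_cases hj : j = i
    · subst hj
      simp [Nat.cast_sub (Nat.one_le_iff_ne_zero.2 hpos.ne')]
    · simp [hj]
  have hne : ∏ j ∈ (range d).erase i, ((x i : ℚ) - x j) / (x i + x j) ≠ 0 := by
    refine prod_ne_zero_iff.2 fun j hj => div_ne_zero (sub_ne_zero.2 ?_) (by positivity)
    obtain ⟨hji, hjd⟩ := mem_erase.1 hj
    rw [mem_range] at hjd
    rcases lt_or_gt_of_ne hji with h | h
    · exact_mod_cast (hx j i h hi).ne
    · exact_mod_cast (hx i j h hjd).ne'
  have hS := schurProduct_update_mul hi (fun j => (x j : ℚ)) ((x i : ℚ) - 1)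
  have hF : ∏ j ∈ range d, ((Function.update x i (x i - 1) j).factorial : ℚ)⁻¹ =
      x i * ∏ j ∈ range d, ((x j).factorial : ℚ)⁻¹ := by
    rw [← mul_prod_erase _ _ hmem, ← mul_prod_erase _ (fun j => ((x j).factorial : ℚ)⁻¹) hmem,
      Function.update_self, ← mul_assoc]
    congr 1
    · rw [← Nat.mul_factorial_pred hpos.ne']
      push_cast
      have : (x i : ℚ) ≠ 0 := by exact_mod_cast hpos.ne'
      field_simp
    · refine prod_congr rfl fun j hj => ?_
      rw [Function.update_of_ne (ne_of_mem_erase hj)]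
  rw [← eq_div_iff hne] at hS
  rw [shiftedFormula, shiftedFormula, hcast, hF, hS,
    prod_div_distrib (fun j => ((x i : ℚ) - 1 - x j) / (x i - 1 + x j))]
  ring

theorem sum_mul_shiftedFormula {d : ℕ} {x : ℕ → ℕ}
    (hx : ∀ i j, i < j → j < d → x j < x i) (hpos : ∀ i < d, 0 < x i) :
    ((∑ i ∈ range d, x i : ℕ) : ℚ) * shiftedFormula d x =
      ∑ i ∈ range d, shiftedFormula d (Function.update x i (x i - 1)) := by
  rw [sum_congr rfl fun i hi =>
    shiftedFormula_update (mem_range.1 hi) hx (hpos i (mem_range.1 hi)), ← sum_mul]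
  congr 1
  rw [sum_mul_prod_shifted_ratio (range d) fun i => (x i : ℚ)]
  · push_cast
    rfl
  · intro i hi j hj hij
    have hi : i < d := by simpa using hi
    have hj : j < d := by simpa using hj
    have h1 : (1 : ℚ) ≤ x i := by exact_mod_cast hpos i hi
    have h2 : (1 : ℚ) ≤ x j := by exact_mod_cast hpos j hj
    have hij : (x i : ℚ) ^ 2 - x i = (x j : ℚ) ^ 2 - x j := hij
    have h3 : ((x i : ℚ) - x j) * (x i + x j - 1) = 0 := by linear_combination hij
    rcases mul_eq_zero.1 h3 with h | h
    · have h : x i = x j := by exact_mod_cast sub_eq_zero.1 h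
      rcases lt_trichotomy i j with hlt | heq | hlt
      · exact absurd h (hx i j hlt hj).ne'
      · exact heq
      · exact absurd h (hx j i hlt hi).ne
    · linarith

theorem add_le_add_of_strictAnti {d r s : ℕ} {x : ℕ → ℕ}
    (hx : ∀ i j, i < j → j < d → x j < x i) (hrs : r ≤ s) (hs : s < d) : s + x s ≤ r + x r := by
  induction s, hrs using Nat.le_induction with
  | base => rfl
  | succ s hrs ih =>
    have := ih (by omega)
    have := hx s (s + 1) (by omega) hs
    omega

theorem update_pred_strictAnti {d r : ℕ} {x : ℕ → ℕ}
    (hx : ∀ i j, i < j → j < d → x j < x i) (hr : r + 1 < d → x (r + 1) + 1 < x r) :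
    ∀ i j, i < j → j < d →
      Function.update x r (x r - 1) j < Function.update x r (x r - 1) i := by
  intro j k hjk hk
  have h2 := hx j k hjk hk
  rcases eq_or_ne j r with rfl | hji
  · rw [Function.update_self, Function.update_of_ne hjk.ne']
    have h3 := hr (by omega)
    rcases eq_or_ne k (j + 1) with rfl | hk1
    · omega
    · have := hx (j + 1) k (by omega) hk
      omega
  · rw [Function.update_of_ne hji]
    rcases eq_or_ne k r with rfl | hki
    · rw [Function.update_self]
      omega
    · rwa [Function.update_of_ne hki]

/-- The shifted diagram with `d` rows of lengths `x 0, …, x (d - 1)`. -/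
def shiftedCells (d : ℕ) (x : ℕ → ℕ) : Finset (ℕ × ℕ) :=
  (range d).biUnion fun r => (Icc (r + 1) (r + x r)).image fun j => (r + 1, j)

theorem mem_shiftedCells {d : ℕ} {x : ℕ → ℕ} {i j : ℕ} :
    (i, j) ∈ shiftedCells d x ↔ ∃ r < d, i = r + 1 ∧ r + 1 ≤ j ∧ j ≤ r + x r := by
  simp only [shiftedCells, mem_biUnion, mem_range, mem_image, mem_Icc, Prod.mk.injEq]
  constructor
  · rintro ⟨r, hr, k, hk, rfl, rfl⟩
    exact ⟨r, hr, rfl, hk⟩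
  · rintro ⟨r, hr, rfl, hk⟩
    exact ⟨r, hr, j, hk, rfl, rfl⟩

theorem card_shiftedCells (d : ℕ) (x : ℕ → ℕ) : #(shiftedCells d x) = ∑ i ∈ range d, x i := by
  rw [shiftedCells, card_biUnion]
  · refine sum_congr rfl fun r _ => ?_
    rw [card_image_of_injective _ (Prod.mk_right_injective _), Nat.card_Icc]
    omega
  · intro r _ r' _ hne
    rw [Function.onFun, disjoint_left]
    grind

theorem shiftedCells_erase {d i : ℕ} {x : ℕ → ℕ} (hi : i < d) (hpos : 0 < x i) :
    (shiftedCells d x).erase (i + 1, i + x i) =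
      shiftedCells d (Function.update x i (x i - 1)) := by
  ext ⟨a, b⟩
  rw [mem_erase, mem_shiftedCells, mem_shiftedCells]
  constructor
  · rintro ⟨hne, r, hr, rfl, h1, h2⟩
    refine ⟨r, hr, rfl, h1, ?_⟩
    rcases eq_or_ne r i with rfl | hri
    · rw [Function.update_self]
      have : b ≠ r + x r := fun h => hne (by rw [h])
      omega
    · rwa [Function.update_of_ne hri]
  · rintro ⟨r, hr, rfl, h1, h2⟩
    rcases eq_or_ne r i with rfl | hri
    · rw [Function.update_self] at h2
      exact ⟨by simp; omega, r, hr, rfl, h1, by omega⟩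
    · rw [Function.update_of_ne hri] at h2
      exact ⟨by simp; omega, r, hr, rfl, h1, h2⟩

theorem corners_shiftedCells {d : ℕ} {x : ℕ → ℕ}
    (hx : ∀ i j, i < j → j < d → x j < x i) (hpos : ∀ i < d, 0 < x i) :
    corners (shiftedCells d x) =
      {i ∈ range d | i + 1 < d → x (i + 1) + 1 < x i}.image fun i => (i + 1, i + x i) := by
  ext ⟨a, b⟩
  simp only [mem_corners, mem_image, mem_filter, mem_range, mem_shiftedCells, Prod.forall,
    Prod.mk.injEq, CellBefore]
  constructor
  · rintro ⟨⟨r, hr, rfl, h1, h2⟩, h⟩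
    have hb : b = r + x r := by
      by_contra hb
      exact h (r + 1) (b + 1) ⟨r, hr, rfl, by omega, by omega⟩ (Or.inl ⟨rfl, by simp⟩)
    refine ⟨r, ⟨hr, fun hr1 => ?_⟩, rfl, hb.symm⟩
    have h3 := hx r (r + 1) (by omega) hr1
    have h4 := hpos (r + 1) hr1
    by_contra h5
    exact h (r + 2) b ⟨r + 1, hr1, rfl, by omega, by omega⟩ (Or.inr ⟨rfl, by simp⟩)
  · rintro ⟨r, ⟨hr, h⟩, rfl, rfl⟩
    have := hpos r hr
    refine ⟨⟨r, hr, rfl, by omega, le_rfl⟩, ?_⟩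
    rintro a b ⟨s, hs, rfl, h1, h2⟩ (⟨h3, h4⟩ | ⟨h3, h4⟩)
    · obtain rfl : r = s := by omega
      omega
    · have h5 := h (by omega)
      have h6 := add_le_add_of_strictAnti hx (show r + 1 ≤ s by omega) hs
      omega

theorem sytDensity_shiftedCells {d : ℕ} {x : ℕ → ℕ} (hx : ∀ i j, i < j → j < d → x j < x i) :
    sytDensity (shiftedCells d x) = shiftedFormula d x := by
  induction hm : d + ∑ i ∈ range d, x i using Nat.strong_induction_on generalizing d x with
  | _ m ih =>
  rcases d with _ | d
  · simp [shiftedCells, shiftedFormula, schurProduct, sytDensity_empty]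
  rcases Nat.eq_zero_or_pos (x d) with h0 | h0
  · have hne : ∏ j ∈ range d, ((x j : ℚ) - x d) / (x j + x d) = 1 := by
      refine prod_eq_one fun j hj => ?_
      have : (x j : ℚ) ≠ 0 := by
        exact_mod_cast (lt_of_le_of_lt (Nat.zero_le _) (hx j d (mem_range.1 hj) (by omega))).ne'
      simp [h0, this]
    have hcells : shiftedCells (d + 1) x = shiftedCells d x := by
      simp [shiftedCells, range_add_one, biUnion_insert, h0]
    rw [hcells, shiftedFormula_succ, hne, h0]
    simp only [Nat.factorial_zero, Nat.cast_one, inv_one, mul_one]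
    refine ih _ ?_ (fun i j hij hj => hx i j hij (by omega)) rfl
    rw [← hm, sum_range_succ]
    omega
  · have hpos : ∀ i < d + 1, 0 < x i := fun i hi => by
      rcases Nat.lt_succ_iff_lt_or_eq.1 hi with h | rfl
      · exact lt_of_le_of_lt (Nat.zero_le _) (hx i d h (by omega))
      · exact h0
    have hcard := card_shiftedCells (d + 1) x
    have hsum : 0 < ∑ i ∈ range (d + 1), x i := by
      rw [sum_range_succ]
      omega
    have hne : (shiftedCells (d + 1) x).Nonempty := by
      rw [← card_pos, hcard]
      exact hsum
    have hrec := card_mul_sytDensity hne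
    rw [corners_shiftedCells hx hpos, sum_image (by intro i _ j _; simp; omega), hcard] at hrec
    have hstep : ∑ i ∈ range (d + 1) with i + 1 < d + 1 → x (i + 1) + 1 < x i,
        sytDensity ((shiftedCells (d + 1) x).erase (i + 1, i + x i)) =
        ∑ i ∈ range (d + 1), shiftedFormula (d + 1) (Function.update x i (x i - 1)) := by
      rw [sum_filter]
      refine sum_congr rfl fun i hi => ?_
      rw [mem_range] at hi
      have hxi := hpos i hi
      split_ifs with h
      · have h1 := shiftedCells_erase hi hxi
        rw [h1]
        refine ih _ ?_ (update_pred_strictAnti hx h) rfl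
        rw [← hm, ← card_shiftedCells, ← h1, card_erase_of_mem, hcard]
        · omega
        · exact mem_shiftedCells.2 ⟨i, hi, rfl, by omega, le_rfl⟩
      · push Not at h
        have h3 := hx i (i + 1) (by omega) h.1
        refine (shiftedFormula_eq_zero (Nat.lt_add_one i) h.1 ?_).symm
        rw [Function.update_self, Function.update_of_ne (by omega)]
        omega
    rw [hstep, ← sum_mul_shiftedFormula hx hpos] at hrec
    exact mul_left_cancel₀ (by exact_mod_cast hsum.ne') hrec

theorem sum_det_updateRow {n : Type*} [Fintype n] [DecidableEq n] (M A : Matrix n n ℚ) :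
    ∑ i, (M.updateRow i (A i)).det = ∑ i, ∑ j, M.adjugate j i * A i j := by
  refine sum_congr rfl fun i _ => ?_
  rw [← Matrix.cramer_transpose_apply, Matrix.cramer_eq_adjugate_mulVec,
    ← Matrix.adjugate_transpose]
  rfl

theorem sum_det_updateCol {n : Type*} [Fintype n] [DecidableEq n] (M A : Matrix n n ℚ) :
    ∑ j, (M.updateCol j fun i => A i j).det = ∑ i, ∑ j, M.adjugate j i * A i j := by
  rw [sum_comm]
  refine sum_congr rfl fun j _ => ?_
  rw [← Matrix.cramer_apply, Matrix.cramer_eq_adjugate_mulVec]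
  rfl

theorem sum_mul_det_eq {n : Type*} [Fintype n] [DecidableEq n] (M R C E : Matrix n n ℚ)
    (u v : n → ℚ) (h : ∀ i j, (u i + v j) * M i j = R i j + C i j + E i j) :
    (∑ i, (u i + v i)) * M.det = ∑ i, (M.updateRow i (R i)).det +
      ∑ j, (M.updateCol j fun i => C i j).det + ∑ i, ∑ j, M.adjugate j i * E i j := by
  have hu := sum_det_updateRow M fun i j => u i * M i j
  have hv := sum_det_updateCol M fun i j => v j * M i j
  have hu' : ∀ i, (M.updateRow i fun j => u i * M i j).det = u i * M.det := fun i => by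
    have := Matrix.det_updateRow_smul M i (u i) (M i)
    rwa [Matrix.updateRow_eq_self] at this
  have hv' : ∀ j, (M.updateCol j fun i => v j * M i j).det = v j * M.det := fun j => by
    have := Matrix.det_updateCol_smul M j (v j) fun i => M i j
    rwa [Matrix.updateCol_eq_self] at this
  simp only [hu', ← sum_mul] at hu
  simp only [hv', ← sum_mul] at hv
  rw [sum_add_distrib, add_mul, hu, hv, sum_det_updateRow, sum_det_updateCol]
  simp only [← sum_add_distrib]
  refine sum_congr rfl fun i _ => sum_congr rfl fun j _ => ?_
  linear_combination M.adjugate j i * h i j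

/-- The density of standard tableaux for the hook with arm `a` and leg `b`. -/
def hookDensity (a b : ℕ) : ℚ := 1 / (a.factorial * b.factorial * (a + b + 1))

theorem hookDensity_comm (a b : ℕ) : hookDensity a b = hookDensity b a := by
  rw [hookDensity, hookDensity]
  ring

theorem mul_hookDensity (a b : ℕ) : ((a : ℚ) + (b + 1)) * hookDensity a b =
    (if a = 0 then 0 else hookDensity (a - 1) b) + (if b = 0 then 0 else hookDensity a (b - 1)) +
      if a = 0 ∧ b = 0 then 1 else 0 := by
  have hf : ∀ k : ℕ, (k.factorial : ℚ) ≠ 0 := fun k => by exact_mod_cast k.factorial_ne_zero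
  rcases a with _ | a <;> rcases b with _ | b
  · simp [hookDensity]
  · have := hf b
    have : (b : ℚ) + 1 + 1 ≠ 0 := by positivity
    have : (b : ℚ) + 1 ≠ 0 := by positivity
    simp [hookDensity, Nat.factorial_succ]
    field_simp
  · have := hf a
    have : (a : ℚ) + 1 + 1 ≠ 0 := by positivity
    have : (a : ℚ) + 1 ≠ 0 := by positivity
    simp [hookDensity, Nat.factorial_succ]
    field_simp
  · have := hf a
    have := hf b
    have : (b : ℚ) + 1 ≠ 0 := by positivity
    have : (a : ℚ) + 1 ≠ 0 := by positivity
    have : (a : ℚ) + b + 2 ≠ 0 := by positivity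
    have h1 : (a : ℚ) + (b + 1) + 1 ≠ 0 := by positivity
    have h2 : (a : ℚ) + 1 + b + 1 ≠ 0 := by positivity
    have h3 : (a : ℚ) + 1 + (b + 1) + 1 ≠ 0 := by positivity
    simp [hookDensity, Nat.factorial_succ]
    field_simp
    ring

/-- Giambelli's matrix of hook densities for the Frobenius coordinates `(a | b)`. -/
def hookMatrix (d : ℕ) (a b : ℕ → ℕ) : Matrix (Fin d) (Fin d) ℚ :=
  Matrix.of fun i j => hookDensity (a i) (b j)

theorem hookMatrix_det_comm (d : ℕ) (a b : ℕ → ℕ) :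
    (hookMatrix d a b).det = (hookMatrix d b a).det := by
  rw [← Matrix.det_transpose]
  congr 1
  ext i j
  exact hookDensity_comm _ _

theorem hookMatrix_update_left (d : ℕ) (a b : ℕ → ℕ) (i : Fin d) (m : ℕ) :
    hookMatrix d (Function.update a i m) b =
      (hookMatrix d a b).updateRow i fun j => hookDensity m (b j) := by
  ext k j
  rcases eq_or_ne k i with rfl | h
  · simp [hookMatrix]
  · simp [hookMatrix, h, Function.update_of_ne (Fin.val_ne_of_ne h)]

theorem hookMatrix_update_right (d : ℕ) (a b : ℕ → ℕ) (j : Fin d) (m : ℕ) :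
    hookMatrix d a (Function.update b j m) =
      (hookMatrix d a b).updateCol j fun i => hookDensity (a i) m := by
  ext i k
  rcases eq_or_ne k j with rfl | h
  · simp [hookMatrix]
  · simp [hookMatrix, h, Function.update_of_ne (Fin.val_ne_of_ne h)]

theorem hookMatrix_det_eq_zero {d i j : ℕ} {a b : ℕ → ℕ} (hij : i < j) (hj : j < d)
    (h : a i = a j) : (hookMatrix d a b).det = 0 := by
  refine Matrix.det_zero_of_row_eq (i := ⟨i, hij.trans hj⟩) (j := ⟨j, hj⟩)
    (by simp [hij.ne]) ?_
  ext k
  simp [hookMatrix, h]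

theorem sum_mul_hookMatrix_det {d : ℕ} {a b : ℕ → ℕ}
    (ha : ∀ i j, i < j → j < d + 1 → a j < a i) (hb : ∀ i j, i < j → j < d + 1 → b j < b i) :
    ((∑ i ∈ range (d + 1), (a i + b i + 1) : ℕ) : ℚ) * (hookMatrix (d + 1) a b).det =
      (∑ i ∈ range (d + 1), if a i = 0 then 0 else
        (hookMatrix (d + 1) (Function.update a i (a i - 1)) b).det) +
      (∑ i ∈ range (d + 1), if b i = 0 then 0 else
        (hookMatrix (d + 1) a (Function.update b i (b i - 1))).det) +
      if a d = 0 ∧ b d = 0 then (hookMatrix d a b).det else 0 := by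
  have key := sum_mul_det_eq (hookMatrix (d + 1) a b)
    (Matrix.of fun i j => if a i = 0 then 0 else hookDensity (a i - 1) (b j))
    (Matrix.of fun i j => if b j = 0 then 0 else hookDensity (a i) (b j - 1))
    (Matrix.of fun i j => if a i = 0 ∧ b j = 0 then 1 else 0)
    (fun i => a i) (fun j => b j + 1) (fun i j => mul_hookDensity (a i) (b j))
  rw [Nat.cast_sum, ← Fin.sum_univ_eq_sum_range (fun i => ((a i + b i + 1 : ℕ) : ℚ)),
    ← Fin.sum_univ_eq_sum_range fun i => if a i = 0 then 0 else
      (hookMatrix (d + 1) (Function.update a i (a i - 1)) b).det,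
    ← Fin.sum_univ_eq_sum_range fun i => if b i = 0 then 0 else
      (hookMatrix (d + 1) a (Function.update b i (b i - 1))).det]
  convert key using 2
  · refine sum_congr rfl fun i _ => ?_
    push_cast
    ring
  · congr 1
    · refine sum_congr rfl fun i _ => ?_
      split_ifs with h
      · refine (Matrix.det_eq_zero_of_row_eq_zero i fun j => ?_).symm
        simp [h]
      · rw [hookMatrix_update_left]
        congr 2
        ext j
        simp [h]
    · refine sum_congr rfl fun j _ => ?_
      split_ifs with h
      · refine (Matrix.det_eq_zero_of_column_eq_zero j fun i => ?_).symm
        simp [h]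
      · rw [hookMatrix_update_right]
        congr 2
        ext i
        simp [h]
  · have hzero : ∀ x : ℕ → ℕ, (∀ i j, i < j → j < d + 1 → x j < x i) →
        ∀ i : Fin (d + 1), x i = 0 → i = Fin.last d := fun x hx i hi => by
      by_contra hne
      have := hx i d (Fin.val_lt_last hne) (by omega)
      omega
    rw [sum_eq_single (Fin.last d), sum_eq_single (Fin.last d)]
    · rw [Matrix.adjugate_fin_succ_eq_det_submatrix]
      simp only [Fin.val_last, Matrix.of_apply, mul_ite, mul_one, mul_zero, Fin.succAbove_last,
        Even.neg_pow ⟨d, rfl⟩, one_pow, one_mul]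
      rfl
    · intro j _ hj
      rw [Matrix.of_apply, if_neg fun h => hj (hzero b hb j h.2), mul_zero]
    · simp
    · intro i _ hi
      refine sum_eq_zero fun j _ => ?_
      rw [Matrix.of_apply, if_neg fun h => hi (hzero a ha i h.1), mul_zero]
    · simp

theorem det_succ_eq_mul_det_schurComplement {d : ℕ} (M : Matrix (Fin (d + 1)) (Fin (d + 1)) ℚ)
    (h : M (Fin.last d) (Fin.last d) ≠ 0) :
    M.det = M (Fin.last d) (Fin.last d) * (Matrix.of fun i j : Fin d =>
      M i.castSucc j.castSucc - M i.castSucc (Fin.last d) * M (Fin.last d) j.castSucc /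
        M (Fin.last d) (Fin.last d)).det := by
  set l := Fin.last d
  have hrow := Matrix.det_eq_of_forall_row_eq_smul_add_const (A := M)
    (B := Matrix.of fun i j => M i j - (if i = l then 0 else M i l / M l l) * M l j)
    (fun i => if i = l then 0 else M i l / M l l) l (by simp) (fun i j => by simp)
  rw [hrow, Matrix.det_succ_column _ l, sum_eq_single l]
  · simp only [Matrix.of_apply, l, Fin.val_last, Fin.succAbove_last, Even.neg_pow ⟨d, rfl⟩,
      one_pow, one_mul, if_true, zero_mul, sub_zero]
    congr 2
    ext i j
    simp [Fin.castSucc_ne_last]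
    ring
  · intro i _ hi
    simp [hi, h]
  · simp

/-- Cauchy's determinant evaluation for the Frobenius coordinates of a double. -/
theorem hookMatrix_pred_det {d : ℕ} {x : ℕ → ℕ} (hpos : ∀ i < d, 0 < x i) :
    (hookMatrix d (fun i => x i - 1) x).det = 1 / 2 ^ d * shiftedFormula d x ^ 2 := by
  induction d with
  | zero => simp [shiftedFormula, schurProduct]
  | succ d ih =>
    have hf : ∀ k : ℕ, (k.factorial : ℚ) ≠ 0 := fun k => by exact_mod_cast k.factorial_ne_zero
    have hhook : ∀ m k : ℕ, 0 < m →
        hookDensity (m - 1) k = m / (m.factorial * k.factorial * (m + k)) := by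
      intro m k hm
      obtain ⟨m, rfl⟩ := Nat.exists_eq_succ_of_ne_zero hm.ne'
      have := hf m
      have := hf k
      have h1 : (m : ℚ) + 1 ≠ 0 := by positivity
      have h2 : (m : ℚ) + k + 1 ≠ 0 := by positivity
      have h3 : (m : ℚ) + 1 + k ≠ 0 := by positivity
      simp only [hookDensity, Nat.succ_eq_add_one, Nat.add_sub_cancel, Nat.factorial_succ]
      push_cast
      field_simp
      ring
    have hd : (0 : ℚ) < x d := by exact_mod_cast hpos d (by omega)
    have hll : hookMatrix (d + 1) (fun i => x i - 1) x (Fin.last d) (Fin.last d) =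
        1 / 2 * (((x d).factorial : ℚ)⁻¹) ^ 2 := by
      have := hf (x d)
      simp only [hookMatrix, Matrix.of_apply, Fin.val_last, hhook _ _ (hpos d (by omega))]
      field_simp
      ring
    set ρ : Fin d → ℚ := fun i => ((x i : ℚ) - x d) / (x i + x d) with hρ
    rw [det_succ_eq_mul_det_schurComplement _ (by rw [hll]; have := hf (x d); positivity)]
    have hS : (Matrix.of fun i j : Fin d =>
        hookMatrix (d + 1) (fun i => x i - 1) x i.castSucc j.castSucc -
        hookMatrix (d + 1) (fun i => x i - 1) x i.castSucc (Fin.last d) *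
        hookMatrix (d + 1) (fun i => x i - 1) x (Fin.last d) j.castSucc /
        hookMatrix (d + 1) (fun i => x i - 1) x (Fin.last d) (Fin.last d)) =
        Matrix.of fun i j => ρ i * (Matrix.of fun i j =>
          ρ j * hookMatrix d (fun i => x i - 1) x i j) i j := by
      ext i j
      have hi : (0 : ℚ) < x i := by exact_mod_cast hpos i (by omega)
      have hj : (0 : ℚ) < x j := by exact_mod_cast hpos j (by omega)
      have := hf (x i)
      have := hf (x j)
      have := hf (x d)
      have h1 : (x d : ℚ) + x j ≠ 0 := by positivity
      have h2 : (x i : ℚ) + x j ≠ 0 := by positivity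
      have h3 : (x i : ℚ) + x d ≠ 0 := by positivity
      have h4 : (x j : ℚ) + x d ≠ 0 := by positivity
      simp only [hookMatrix, Matrix.of_apply, Fin.val_last, Fin.val_castSucc, hρ,
        hhook _ _ (hpos d (by omega)), hhook _ _ (hpos i (by omega))]
      field_simp
      ring
    rw [hS, Matrix.det_mul_column, Matrix.det_mul_row, ih fun i hi => hpos i (by omega), hll,
      shiftedFormula_succ, ← Fin.prod_univ_eq_prod_range fun j => ((x j : ℚ) - x d) / (x j + x d)]
    ring

/-- The cells of the partition with Frobenius coordinates `(a | b)`, with indices from one. -/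
def frobeniusCells (d : ℕ) (a b : ℕ → ℕ) : Finset (ℕ × ℕ) :=
  (range d).biUnion fun r => ((Icc (r + 1) (r + 1 + a r)).image fun j => (r + 1, j)) ∪
    ((Icc (r + 2) (r + 1 + b r)).image fun j => (j, r + 1))

theorem mem_frobeniusCells {d : ℕ} {a b : ℕ → ℕ} {i j : ℕ} :
    (i, j) ∈ frobeniusCells d a b ↔ ∃ r < d, (i = r + 1 ∧ r + 1 ≤ j ∧ j ≤ r + 1 + a r) ∨
      (j = r + 1 ∧ r + 1 ≤ i ∧ i ≤ r + 1 + b r) := by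
  simp only [frobeniusCells, mem_biUnion, mem_union, mem_range, mem_image, mem_Icc, Prod.mk.injEq]
  constructor
  · rintro ⟨r, hr, ⟨k, hk, rfl, rfl⟩ | ⟨k, hk, rfl, rfl⟩⟩
    · exact ⟨r, hr, Or.inl ⟨rfl, hk⟩⟩
    · exact ⟨r, hr, Or.inr ⟨rfl, by omega, hk.2⟩⟩
  · rintro ⟨r, hr, ⟨rfl, hk⟩ | ⟨rfl, hk⟩⟩
    · exact ⟨r, hr, Or.inl ⟨j, hk, rfl, rfl⟩⟩
    · rcases eq_or_ne i (r + 1) with rfl | hne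
      · exact ⟨r, hr, Or.inl ⟨r + 1, by omega, rfl, rfl⟩⟩
      · exact ⟨r, hr, Or.inr ⟨i, by omega, rfl, rfl⟩⟩

theorem mem_frobeniusCells_swap {d : ℕ} {a b : ℕ → ℕ} {i j : ℕ} :
    (i, j) ∈ frobeniusCells d a b ↔ (j, i) ∈ frobeniusCells d b a := by
  simp only [mem_frobeniusCells, or_comm]

theorem card_frobeniusCells (d : ℕ) (a b : ℕ → ℕ) :
    #(frobeniusCells d a b) = ∑ r ∈ range d, (a r + b r + 1) := by
  rw [frobeniusCells, card_biUnion]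
  · refine sum_congr rfl fun r _ => ?_
    rw [card_union_of_disjoint, card_image_of_injective _ (Prod.mk_right_injective _),
      card_image_of_injective _ (Prod.mk_left_injective _), Nat.card_Icc, Nat.card_Icc]
    · omega
    · rw [disjoint_left]
      simp only [mem_image, mem_Icc]
      rintro _ ⟨j, hj, rfl⟩ ⟨k, hk, h⟩
      rw [Prod.mk.injEq] at h
      omega
  · intro r _ r' _ hne
    rw [Function.onFun, disjoint_left]
    simp only [mem_union, mem_image, mem_Icc]
    rintro _ (⟨j, hj, rfl⟩ | ⟨j, hj, rfl⟩) (⟨k, hk, h⟩ | ⟨k, hk, h⟩) <;>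
      rw [Prod.mk.injEq] at h <;> omega

theorem frobeniusCells_erase_arm {d i : ℕ} {a b : ℕ → ℕ} (hi : i < d) (hpos : a i ≠ 0) :
    (frobeniusCells d a b).erase (i + 1, i + 1 + a i) =
      frobeniusCells d (Function.update a i (a i - 1)) b := by
  ext ⟨p, q⟩
  rw [mem_erase, mem_frobeniusCells, mem_frobeniusCells]
  constructor
  · rintro ⟨hne, r, hr, ⟨rfl, h1, h2⟩ | h⟩
    · refine ⟨r, hr, Or.inl ⟨rfl, h1, ?_⟩⟩
      rcases eq_or_ne r i with rfl | hri
      · rw [Function.update_self]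
        have : q ≠ r + 1 + a r := fun h => hne (by rw [h])
        omega
      · rwa [Function.update_of_ne hri]
    · exact ⟨r, hr, Or.inr h⟩
  · rintro ⟨r, hr, ⟨rfl, h1, h2⟩ | h⟩
    · rcases eq_or_ne r i with rfl | hri
      · rw [Function.update_self] at h2
        exact ⟨by simp; omega, r, hr, Or.inl ⟨rfl, h1, by omega⟩⟩
      · rw [Function.update_of_ne hri] at h2
        exact ⟨by simp; omega, r, hr, Or.inl ⟨rfl, h1, h2⟩⟩
    · refine ⟨?_, r, hr, Or.inr h⟩
      rw [Ne, Prod.mk.injEq]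
      omega

theorem frobeniusCells_erase_leg {d i : ℕ} {a b : ℕ → ℕ} (hi : i < d) (hpos : b i ≠ 0) :
    (frobeniusCells d a b).erase (i + 1 + b i, i + 1) =
      frobeniusCells d a (Function.update b i (b i - 1)) := by
  ext ⟨p, q⟩
  rw [mem_frobeniusCells_swap, ← frobeniusCells_erase_arm hi hpos, mem_erase, mem_erase,
    mem_frobeniusCells_swap, Ne, Ne, Prod.mk.injEq, Prod.mk.injEq, and_comm (a := p = _)]

theorem frobeniusCells_erase_diag {d : ℕ} {a b : ℕ → ℕ} (ha : a d = 0) (hb : b d = 0) :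
    (frobeniusCells (d + 1) a b).erase (d + 1, d + 1) = frobeniusCells d a b := by
  ext ⟨p, q⟩
  rw [mem_erase, mem_frobeniusCells, mem_frobeniusCells, Ne, Prod.mk.injEq]
  constructor
  · rintro ⟨hne, r, hr, h⟩
    refine ⟨r, ?_, h⟩
    rcases Nat.lt_succ_iff_lt_or_eq.1 hr with hr | rfl
    · exact hr
    · omega
  · rintro ⟨r, hr, h⟩
    exact ⟨by omega, r, by omega, h⟩

theorem cellBefore_swap {c c' : ℕ × ℕ} : CellBefore c.swap c'.swap ↔ CellBefore c c' := by
  simp only [CellBefore, Prod.fst_swap, Prod.snd_swap]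
  tauto

theorem mem_corners_frobeniusCells_swap {d : ℕ} {a b : ℕ → ℕ} {i j : ℕ} :
    (i, j) ∈ corners (frobeniusCells d a b) ↔ (j, i) ∈ corners (frobeniusCells d b a) := by
  rw [mem_corners, mem_corners, mem_frobeniusCells_swap]
  refine and_congr_right fun _ => ⟨fun h c hc hb => ?_, fun h c hc hb => ?_⟩
  · exact h c.swap (mem_frobeniusCells_swap.1 hc) (cellBefore_swap.2 hb)
  · exact h c.swap (mem_frobeniusCells_swap.1 hc) (cellBefore_swap.2 hb)

theorem mem_corners_frobeniusCells_of_lt {d : ℕ} {a b : ℕ → ℕ} {i j : ℕ}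
    (ha : ∀ i j, i < j → j < d → a j < a i) (hij : i < j) :
    (i, j) ∈ corners (frobeniusCells d a b) ↔
      ∃ r < d, (a r ≠ 0 ∧ (r + 1 < d → a (r + 1) + 1 < a r)) ∧ i = r + 1 ∧ j = r + 1 + a r := by
  simp only [mem_corners, mem_frobeniusCells, Prod.forall, CellBefore]
  constructor
  · rintro ⟨⟨r, hr, ⟨rfl, h1, h2⟩ | h1⟩, h⟩
    · have hj : j = r + 1 + a r := by
        by_contra hj
        exact h (r + 1) (j + 1) ⟨r, hr, Or.inl ⟨rfl, by omega, by omega⟩⟩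
          (Or.inl ⟨rfl, Nat.lt_add_one j⟩)
      refine ⟨r, hr, ⟨by omega, fun hr1 => ?_⟩, rfl, hj⟩
      have h3 := ha r (r + 1) (by omega) hr1
      by_contra h5
      exact h (r + 2) j ⟨r + 1, hr1, Or.inl ⟨rfl, by omega, by omega⟩⟩
        (Or.inr ⟨rfl, Nat.lt_add_one (r + 1)⟩)
    · omega
  · rintro ⟨r, hr, ⟨h0, h⟩, rfl, rfl⟩
    refine ⟨⟨r, hr, Or.inl ⟨rfl, by omega, le_rfl⟩⟩, ?_⟩
    rintro p q ⟨s, hs, ⟨rfl, h1, h2⟩ | ⟨rfl, h1, h2⟩⟩ (⟨h3, h4⟩ | ⟨h3, h4⟩)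
    · obtain rfl : r = s := by omega
      omega
    · have h5 := h (by omega)
      have h6 := add_le_add_of_strictAnti ha (show r + 1 ≤ s by omega) hs
      omega
    · omega
    · have h7 : s = r + a r := by omega
      have h5 := h (by omega)
      have h6 := add_le_add_of_strictAnti ha (show r + 1 ≤ d - 1 by omega) (by omega)
      omega

theorem mem_corners_frobeniusCells_diag {d : ℕ} {a b : ℕ → ℕ} {i : ℕ}
    (ha : ∀ i j, i < j → j < d + 1 → a j < a i) (hb : ∀ i j, i < j → j < d + 1 → b j < b i) :
    (i, i) ∈ corners (frobeniusCells (d + 1) a b) ↔ (a d = 0 ∧ b d = 0) ∧ i = d + 1 := by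
  simp only [mem_corners, mem_frobeniusCells, Prod.forall, CellBefore]
  constructor
  · rintro ⟨⟨r, hr, h1⟩, h⟩
    obtain rfl : i = r + 1 := by omega
    have har : a r = 0 := by
      by_contra h0
      exact h (r + 1) (r + 2) ⟨r, hr, Or.inl ⟨rfl, by omega, by omega⟩⟩
        (Or.inl ⟨rfl, Nat.lt_add_one _⟩)
    have hbr : b r = 0 := by
      by_contra h0
      exact h (r + 2) (r + 1) ⟨r, hr, Or.inr ⟨rfl, by omega, by omega⟩⟩
        (Or.inr ⟨rfl, Nat.lt_add_one _⟩)
    rcases Nat.lt_succ_iff_lt_or_eq.1 hr with hr | rfl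
    · have := ha r d hr (by omega)
      omega
    · exact ⟨⟨har, hbr⟩, rfl⟩
  · rintro ⟨⟨h1, h2⟩, rfl⟩
    refine ⟨⟨d, by omega, by omega⟩, ?_⟩
    rintro p q ⟨s, hs, h3⟩ h4
    rcases Nat.lt_succ_iff_lt_or_eq.1 hs with hs | rfl <;> omega

theorem corners_frobeniusCells {d : ℕ} {a b : ℕ → ℕ}
    (ha : ∀ i j, i < j → j < d + 1 → a j < a i) (hb : ∀ i j, i < j → j < d + 1 → b j < b i) :
    corners (frobeniusCells (d + 1) a b) =
      (({i ∈ range (d + 1) | a i ≠ 0 ∧ (i + 1 < d + 1 → a (i + 1) + 1 < a i)}.image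
          fun i => (i + 1, i + 1 + a i)) ∪
        ({i ∈ range (d + 1) | b i ≠ 0 ∧ (i + 1 < d + 1 → b (i + 1) + 1 < b i)}.image
          fun i => (i + 1 + b i, i + 1))) ∪
        if a d = 0 ∧ b d = 0 then {(d + 1, d + 1)} else ∅ := by
  have hif : ∀ c : ℕ × ℕ, (c ∈ if a d = 0 ∧ b d = 0 then ({(d + 1, d + 1)} : Finset _) else ∅) ↔
      (a d = 0 ∧ b d = 0) ∧ c = (d + 1, d + 1) := fun c => by
    split_ifs with h <;> simp [h]
  ext ⟨i, j⟩
  simp only [mem_union, hif, mem_image, mem_filter, mem_range, Prod.mk.injEq]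
  rcases lt_trichotomy i j with hij | rfl | hij
  · rw [mem_corners_frobeniusCells_of_lt ha hij]
    constructor
    · rintro ⟨r, hr, h, rfl, rfl⟩
      exact Or.inl (Or.inl ⟨r, ⟨hr, h⟩, rfl, rfl⟩)
    · rintro ((⟨r, ⟨hr, h⟩, rfl, rfl⟩ | ⟨r, ⟨hr, h⟩, rfl, rfl⟩) | h)
      · exact ⟨r, hr, h, rfl, rfl⟩
      · omega
      · omega
  · rw [mem_corners_frobeniusCells_diag ha hb]
    constructor
    · rintro ⟨h, rfl⟩
      exact Or.inr ⟨h, rfl, rfl⟩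
    · rintro ((⟨r, ⟨hr, h⟩, h1⟩ | ⟨r, ⟨hr, h⟩, h1⟩) | h)
      · omega
      · omega
      · exact ⟨h.1, h.2.1⟩
  · rw [mem_corners_frobeniusCells_swap, mem_corners_frobeniusCells_of_lt hb hij]
    constructor
    · rintro ⟨r, hr, h, rfl, rfl⟩
      exact Or.inl (Or.inr ⟨r, ⟨hr, h⟩, rfl, rfl⟩)
    · rintro ((⟨r, ⟨hr, h⟩, rfl, rfl⟩ | ⟨r, ⟨hr, h⟩, rfl, rfl⟩) | h)
      · omega
      · exact ⟨r, hr, h, rfl, rfl⟩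
      · omega

theorem sum_corners_frobeniusCells {d : ℕ} {a b : ℕ → ℕ}
    (ha : ∀ i j, i < j → j < d + 1 → a j < a i) (hb : ∀ i j, i < j → j < d + 1 → b j < b i)
    (f : ℕ × ℕ → ℚ) :
    ∑ c ∈ corners (frobeniusCells (d + 1) a b), f c =
      (∑ i ∈ range (d + 1) with a i ≠ 0 ∧ (i + 1 < d + 1 → a (i + 1) + 1 < a i),
        f (i + 1, i + 1 + a i)) +
      (∑ i ∈ range (d + 1) with b i ≠ 0 ∧ (i + 1 < d + 1 → b (i + 1) + 1 < b i),
        f (i + 1 + b i, i + 1)) +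
      if a d = 0 ∧ b d = 0 then f (d + 1, d + 1) else 0 := by
  rw [corners_frobeniusCells ha hb, sum_union, sum_union,
    sum_image (by intro i _ j _; simp; omega), sum_image (by intro i _ j _; simp)]
  · congr 1
    split_ifs <;> simp
  · rw [disjoint_left]
    simp only [mem_image, mem_filter]
    rintro _ ⟨r, ⟨hr, h⟩, rfl⟩ ⟨s, ⟨hs, h'⟩, h1⟩
    rw [Prod.mk.injEq] at h1
    omega
  · rw [disjoint_left]
    simp only [mem_union, mem_image, mem_filter]
    rintro _ (⟨r, ⟨hr, h⟩, rfl⟩ | ⟨r, ⟨hr, h⟩, rfl⟩) h1 <;> split_ifs at h1 <;>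
      simp at h1 <;> omega

/-- Giambelli's formula for the density of standard tableaux in Frobenius coordinates. -/
theorem sytDensity_frobeniusCells {d : ℕ} {a b : ℕ → ℕ}
    (ha : ∀ i j, i < j → j < d → a j < a i) (hb : ∀ i j, i < j → j < d → b j < b i) :
    sytDensity (frobeniusCells d a b) = (hookMatrix d a b).det := by
  induction hm : #(frobeniusCells d a b) using Nat.strong_induction_on generalizing d a b with
  | _ m ih =>
  rcases d with _ | d
  · simp [frobeniusCells, sytDensity_empty]
  have hcard := card_frobeniusCells (d + 1) a b
  have hpos : 0 < ∑ i ∈ range (d + 1), (a i + b i + 1) := by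
    rw [sum_range_succ]
    omega
  have hne : (frobeniusCells (d + 1) a b).Nonempty := by
    rw [← card_pos, hcard]
    exact hpos
  have hlt : ∀ c ∈ corners (frobeniusCells (d + 1) a b),
      #((frobeniusCells (d + 1) a b).erase c) < m := fun c hc => by
    rw [← hm]
    exact card_erase_lt_of_mem (mem_corners.1 hc).1
  have hrec := card_mul_sytDensity hne
  rw [sum_corners_frobeniusCells ha hb, hcard] at hrec
  have harm : (∑ i ∈ range (d + 1) with a i ≠ 0 ∧ (i + 1 < d + 1 → a (i + 1) + 1 < a i),
      sytDensity ((frobeniusCells (d + 1) a b).erase (i + 1, i + 1 + a i))) =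
      ∑ i ∈ range (d + 1), if a i = 0 then 0 else
        (hookMatrix (d + 1) (Function.update a i (a i - 1)) b).det := by
    rw [sum_filter]
    refine sum_congr rfl fun i hi => ?_
    rw [mem_range] at hi
    by_cases h0 : a i = 0
    · simp [h0]
    rw [if_neg h0]
    split_ifs with h
    · have hl := hlt (i + 1, i + 1 + a i)
        ((mem_corners_frobeniusCells_of_lt ha (by omega)).2 ⟨i, hi, h, rfl, rfl⟩)
      rw [frobeniusCells_erase_arm hi h0] at hl ⊢
      exact ih _ hl (update_pred_strictAnti ha h.2) hb rfl
    · have h' : i + 1 < d + 1 ∧ a i ≤ a (i + 1) + 1 := by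
        by_contra hcon
        exact h ⟨h0, by omega⟩
      have h3 := ha i (i + 1) (by omega) h'.1
      refine (hookMatrix_det_eq_zero (Nat.lt_add_one i) h'.1 ?_).symm
      rw [Function.update_self, Function.update_of_ne (by omega)]
      omega
  have hleg : (∑ i ∈ range (d + 1) with b i ≠ 0 ∧ (i + 1 < d + 1 → b (i + 1) + 1 < b i),
      sytDensity ((frobeniusCells (d + 1) a b).erase (i + 1 + b i, i + 1))) =
      ∑ i ∈ range (d + 1), if b i = 0 then 0 else
        (hookMatrix (d + 1) a (Function.update b i (b i - 1))).det := by
    rw [sum_filter]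
    refine sum_congr rfl fun i hi => ?_
    rw [mem_range] at hi
    by_cases h0 : b i = 0
    · simp [h0]
    rw [if_neg h0]
    split_ifs with h
    · have hl := hlt (i + 1 + b i, i + 1) (mem_corners_frobeniusCells_swap.2
        ((mem_corners_frobeniusCells_of_lt hb (by omega)).2 ⟨i, hi, h, rfl, rfl⟩))
      rw [frobeniusCells_erase_leg hi h0] at hl ⊢
      exact ih _ hl ha (update_pred_strictAnti hb h.2) rfl
    · have h' : i + 1 < d + 1 ∧ b i ≤ b (i + 1) + 1 := by
        by_contra hcon
        exact h ⟨h0, by omega⟩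
      have h3 := hb i (i + 1) (by omega) h'.1
      rw [hookMatrix_det_comm]
      refine (hookMatrix_det_eq_zero (Nat.lt_add_one i) h'.1 ?_).symm
      rw [Function.update_self, Function.update_of_ne (by omega)]
      omega
  have hdiag : (if a d = 0 ∧ b d = 0 then
      sytDensity ((frobeniusCells (d + 1) a b).erase (d + 1, d + 1)) else 0) =
      if a d = 0 ∧ b d = 0 then (hookMatrix d a b).det else 0 := by
    split_ifs with h
    · have hl := hlt (d + 1, d + 1) ((mem_corners_frobeniusCells_diag ha hb).2 ⟨h, rfl⟩)
      rw [frobeniusCells_erase_diag h.1 h.2] at hl ⊢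
      exact ih _ hl (fun i j hij hj => ha i j hij (by omega))
        (fun i j hij hj => hb i j hij (by omega)) rfl
    · rfl
  rw [harm, hleg, hdiag, ← sum_mul_hookMatrix_det ha hb] at hrec
  exact mul_left_cancel₀ (by exact_mod_cast hpos.ne') hrec

theorem shiftedDiagram_eq_shiftedCells (ℓ : ℕ) (lam : ℕ → ℕ) :
    shiftedDiagram ℓ lam = shiftedCells ℓ fun r => lam (r + 1) := by
  ext ⟨i, j⟩
  simp only [shiftedDiagram, mem_shiftedCells, mem_biUnion, mem_image, mem_Icc, Prod.mk.injEq]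
  constructor
  · rintro ⟨r, hr, k, hk, rfl, rfl⟩
    exact ⟨r - 1, by omega, by omega, by omega, by rw [Nat.sub_add_cancel hr.1]; omega⟩
  · rintro ⟨r, hr, rfl, hk⟩
    exact ⟨r + 1, by omega, j, by omega, rfl, rfl⟩

theorem doubleDiagram_eq_frobeniusCells {ℓ : ℕ} {lam : ℕ → ℕ}
    (hpos : ∀ i, 1 ≤ i → i ≤ ℓ → 0 < lam i) :
    doubleDiagram ℓ lam =
      frobeniusCells ℓ (fun r => lam (r + 1) - 1) fun r => lam (r + 1) := by
  ext ⟨i, j⟩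
  simp only [doubleDiagram, frobeniusCells, mem_biUnion, mem_union, mem_image, mem_Icc,
    mem_range, Prod.mk.injEq]
  constructor
  · rintro ⟨r, hr, h⟩
    obtain ⟨r, rfl⟩ := Nat.exists_eq_add_of_le' hr.1
    have := hpos (r + 1) hr.1 hr.2
    refine ⟨r, by omega, ?_⟩
    rwa [Nat.add_sub_assoc this] at h
  · rintro ⟨r, hr, h⟩
    have := hpos (r + 1) (by omega) hr
    refine ⟨r + 1, by omega, ?_⟩
    rwa [Nat.add_sub_assoc this]

/-- For a strict partition `λ` of `n` with `ℓ` parts,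
`f^{D(λ)} / (2n)! = 2^{-ℓ} (g^λ / n!)²`, where `f^{D(λ)}` is the number of standard
Young tableaux of shape `D(λ)` and `g^λ` is the number of standard shifted Young
tableaux of shape `λ`. -/
theorem numSYT_double_eq (ℓ n : ℕ) (lam : ℕ → ℕ)
    (hpos : ∀ i, 1 ≤ i → i ≤ ℓ → 0 < lam i)
    (hstrict : ∀ i, 1 ≤ i → i < ℓ → lam (i + 1) < lam i)
    (hzero : ∀ i, ℓ < i → lam i = 0)
    (hsum : ∑ i ∈ Finset.Icc 1 ℓ, lam i = n) :
    (numSYT (doubleDiagram ℓ lam) : ℚ) / (Nat.factorial (2 * n)) =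
      (1 / 2 ^ ℓ) * ((numSYT (shiftedDiagram ℓ lam) : ℚ) / Nat.factorial n) ^ 2 := by
  have hx : ∀ i j, i < j → j < ℓ → lam (j + 1) < lam (i + 1) := by
    intro i j hij
    induction j, hij using Nat.le_induction with
    | base => exact fun hj => hstrict (i + 1) (by omega) hj
    | succ j hij ih => exact fun hj => (hstrict (j + 1) (by omega) hj).trans (ih (by omega))
  have hx' : ∀ i j, i < j → j < ℓ → lam (j + 1) - 1 < lam (i + 1) - 1 := fun i j hij hj => by
    have := hx i j hij hj
    have := hpos (j + 1) (by omega) hj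
    omega
  have hpos' : ∀ i < ℓ, 0 < lam (i + 1) := fun i hi => hpos (i + 1) (by omega) hi
  have hn : ∑ i ∈ range ℓ, lam (i + 1) = n := by
    rw [← hsum, range_eq_Ico, sum_Ico_add' lam 0 ℓ 1]
    rfl
  have hshift := card_shiftedCells ℓ fun r => lam (r + 1)
  have hdouble : #(doubleDiagram ℓ lam) = 2 * n := by
    rw [doubleDiagram_eq_frobeniusCells hpos, card_frobeniusCells, ← hn, mul_sum]
    refine sum_congr rfl fun i hi => ?_
    have := hpos' i (mem_range.1 hi)
    omega
  rw [← shiftedDiagram_eq_shiftedCells, hn] at hshift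
  have hF := sytDensity_frobeniusCells hx' hx
  have hG := sytDensity_shiftedCells hx
  rw [← doubleDiagram_eq_frobeniusCells hpos, hookMatrix_pred_det hpos', ← hG,
    ← shiftedDiagram_eq_shiftedCells, sytDensity, sytDensity, hdouble, hshift] at hF
  exact hF
end
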